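/- arXiv:2511.14915 — 2 statements merged into one kernel-verified Lean document; each statement's English description precedes it below -/
import Mathlib

section
/- Let N ≥ 2 and let H be an H-matrix satisfying the H-invariance conditions P(N−1,m;H) = (1/N)·C(N,m+1) for m = 1,…,N−1. If λ*_{i₀,j₀}(H) < 0 for some 1 ≤ j₀ < i₀ ≤ N, then there exist a nonexpansive map T : ℝ^{N+1} → ℝ^{N+1} with a fixed point y⋆ and an initial point y₀ ∈ ℝ^{N+1} with ‖y₀ − y⋆‖ = 1 such that the iterates of the H-matrix algorithm satisfy ‖y_{N−1} − T y_{N−1}‖² > 4/N². -/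
open Finset

/-- `Pinv H k m` is `P(k,m;H)`: the sum over all index sequences
`1 ≤ j(1) ≤ i(1) < j(2) ≤ i(2) < ⋯ < j(m) ≤ i(m) ≤ k` of `∏_{r} h_{i(r),j(r)}`,
with `P(k,0;H) = 1`. -/
noncomputable def Pinv (H : ℕ → ℕ → ℝ) (k : ℕ) : ℕ → ℝ
  | 0 => 1
  | m + 1 =>
    ∑ f : Fin (m + 1) → Fin (k + 1) × Fin (k + 1),
      if (∀ r, 1 ≤ ((f r).2 : ℕ) ∧ ((f r).2 : ℕ) ≤ ((f r).1 : ℕ)) ∧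
          (∀ r : Fin m, ((f r.castSucc).1 : ℕ) < ((f r.succ).2 : ℕ)) then
        ∏ r, H ((f r).1 : ℕ) ((f r).2 : ℕ)
      else 0

/-- `Qinv H k m j` is `Q(k,m,j;H)`: the partial sum of `P(k,m;H)` over those index
sequences with `j(1) = j` (zero if no such sequence exists, and zero for `m = 0`). -/
noncomputable def Qinv (H : ℕ → ℕ → ℝ) (k : ℕ) : ℕ → ℕ → ℝ
  | 0, _ => 0
  | m + 1, j =>
    ∑ f : Fin (m + 1) → Fin (k + 1) × Fin (k + 1),
      if (∀ r, 1 ≤ ((f r).2 : ℕ) ∧ ((f r).2 : ℕ) ≤ ((f r).1 : ℕ)) ∧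
          (∀ r : Fin m, ((f r.castSucc).1 : ℕ) < ((f r.succ).2 : ℕ)) ∧
          ((f 0).2 : ℕ) = j then
        ∏ r, H ((f r).1 : ℕ) ((f r).2 : ℕ)
      else 0

/-- The H-certificates `λ*_{k,j}(H)`:
`λ*_{N,j}(H) = N·Σ_{m=1}^{N−j} (−1)^{m−1}·Q(N−1,m,j;H)` for `j = 1,…,N−1`, and
`λ*_{k,j}(H) = N·Σ_{ℓ=1}^{N−j} Σ_{m=1}^{N−k} (−1)^{ℓ+m−1}·C(ℓ+m,m)·Q(N−1,ℓ,j;H)·Q(N−1,m,k;H)`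
for `1 ≤ j < k ≤ N−1`. -/
noncomputable def lamStar (N : ℕ) (H : ℕ → ℕ → ℝ) (k j : ℕ) : ℝ :=
  if k = N then
    (N : ℝ) * ∑ m ∈ Finset.Icc 1 (N - j), (-1 : ℝ) ^ (m - 1) * Qinv H (N - 1) m j
  else
    (N : ℝ) * ∑ l ∈ Finset.Icc 1 (N - j), ∑ m ∈ Finset.Icc 1 (N - k),
      (-1 : ℝ) ^ (l + m - 1) * (Nat.choose (l + m) m : ℝ) *
        Qinv H (N - 1) l j * Qinv H (N - 1) m k

lemma sum_sum_ite_eq_sum_Ico (K j : ℕ) (F : ℕ → ℝ) :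
    (∑ x : Fin (K + 1), ∑ y : Fin (K + 1),
      if (1 ≤ (y : ℕ) ∧ (y : ℕ) ≤ x) ∧ (y : ℕ) = j + 1 then F x else 0) =
      ∑ i ∈ Ico j K, F (i + 1) := by
  have hy (x : Fin (K + 1)) : (∑ y : Fin (K + 1),
      if (1 ≤ (y : ℕ) ∧ (y : ℕ) ≤ x) ∧ (y : ℕ) = j + 1 then F x else 0) =
      if j + 1 ≤ (x : ℕ) then F x else 0 := by
    by_cases hx : j + 1 ≤ (x : ℕ)
    · rw [sum_eq_single (⟨j + 1, by omega⟩ : Fin (K + 1))]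
      · simp [hx]
      · intro b _ hb
        exact if_neg fun h => hb (Fin.ext h.2)
      · simp
    · rw [if_neg hx]
      exact sum_eq_zero fun y _ => by rw [if_neg (by omega)]
  simp_rw [hy]
  rw [Fin.sum_univ_eq_sum_range (fun x => if j + 1 ≤ x then F x else 0), sum_range_succ',
    if_neg (by omega), add_zero, ← sum_filter]
  refine sum_congr ?_ fun _ _ => rfl
  ext i
  simp only [mem_filter, mem_range, mem_Ico]
  omega

lemma Qinv_one (H : ℕ → ℕ → ℝ) (K j : ℕ) :
    Qinv H K 1 (j + 1) = ∑ i ∈ Ico j K, H (i + 1) (j + 1) := by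
  rw [Qinv, ← (Equiv.funUnique (Fin 1) _).symm.sum_comp, Fintype.sum_prod_type,
    ← sum_sum_ite_eq_sum_Ico K j fun x => H x (j + 1)]
  refine sum_congr rfl fun x _ => sum_congr rfl fun y _ => ?_
  by_cases hy : (y : ℕ) = j + 1 <;> simp [hy]

lemma Qinv_succ (H : ℕ → ℕ → ℝ) (K m j : ℕ) :
    Qinv H K (m + 2) (j + 1) =
      ∑ i ∈ Ico j K, H (i + 1) (j + 1) * ∑ l ∈ Ico (i + 1) K, Qinv H K (m + 1) (l + 1) := by
  rw [Qinv, ← (Fin.consEquiv fun _ : Fin (m + 2) => Fin (K + 1) × Fin (K + 1)).sum_comp,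
    Fintype.sum_prod_type, Fintype.sum_prod_type,
    ← sum_sum_ite_eq_sum_Ico K j fun x =>
      H x (j + 1) * ∑ l ∈ Ico x K, Qinv H K (m + 1) (l + 1)]
  refine sum_congr rfl fun x _ => sum_congr rfl fun y _ => ?_
  simp only [Fin.consEquiv_apply, Fin.forall_fin_succ (n := m + 1), Fin.cons_zero, Fin.cons_succ,
    Fin.forall_fin_succ (n := m), Fin.castSucc_zero, Fin.prod_univ_succ (n := m + 1),
    ← Fin.succ_castSucc]
  by_cases h : (1 ≤ (y : ℕ) ∧ (y : ℕ) ≤ x) ∧ (y : ℕ) = j + 1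
  · rw [if_pos h]
    simp only [Qinv]
    rw [sum_comm, mul_sum]
    refine sum_congr rfl fun g _ => ?_
    rw [h.2]
    by_cases hg : (∀ r, 1 ≤ ((g r).2 : ℕ) ∧ ((g r).2 : ℕ) ≤ ((g r).1 : ℕ)) ∧
        (∀ r : Fin m, ((g r.castSucc).1 : ℕ) < ((g r.succ).2 : ℕ))
    · have hg' := hg.1
      rw [Fin.forall_fin_succ] at hg'
      have h0 := hg'.1
      have hxy := h.1
      rw [h.2] at hxy
      by_cases hx : (x : ℕ) < (g 0).2
      · rw [if_pos ⟨⟨hxy, hg'⟩, ⟨hx, hg.2⟩, rfl⟩,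
          sum_eq_single_of_mem (((g 0).2 : ℕ) - 1)]
        · rw [if_pos ⟨hg.1, hg.2, by omega⟩]
        · have := (g 0).2.2
          simp only [mem_Ico]; omega
        · intro b _ hb
          exact if_neg fun h' => hb (by omega)
      · rw [if_neg fun h' => hx h'.2.1.1, sum_eq_zero, mul_zero]
        intro l hl
        rw [mem_Ico] at hl
        exact if_neg fun h' => by omega
    · rw [if_neg, sum_eq_zero, mul_zero]
      · exact fun l _ => if_neg fun h' => hg ⟨h'.1, h'.2.1⟩
      · rintro ⟨⟨-, h1⟩, ⟨-, h2⟩, -⟩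
        exact hg ⟨Fin.forall_fin_succ.2 h1, h2⟩
  · rw [if_neg h]
    refine sum_eq_zero fun g _ => if_neg fun h' => h ⟨h'.1.1, h'.2.2⟩

lemma Pinv_succ (H : ℕ → ℕ → ℝ) (K m : ℕ) :
    Pinv H K (m + 1) = ∑ j ∈ range K, Qinv H K (m + 1) (j + 1) := by
  simp only [Pinv, Qinv]
  rw [sum_comm]
  refine sum_congr rfl fun f _ => ?_
  by_cases h : (∀ r, 1 ≤ ((f r).2 : ℕ) ∧ ((f r).2 : ℕ) ≤ ((f r).1 : ℕ)) ∧
          (∀ r : Fin m, ((f r.castSucc).1 : ℕ) < ((f r.succ).2 : ℕ))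
  · have h0 := h.1 0
    have h1 := (f 0).2.2
    rw [if_pos h, sum_eq_single_of_mem (((f 0).2 : ℕ) - 1)]
    · rw [if_pos ⟨h.1, h.2, by omega⟩]
    · rw [mem_range]; omega
    · exact fun b _ hb => if_neg fun h' => hb (by omega)
  · rw [if_neg h, sum_eq_zero]
    exact fun j _ => if_neg fun h' => h ⟨h'.1, h'.2.1⟩

lemma Qinv_eq_zero (H : ℕ → ℕ → ℝ) {K m j : ℕ} (h : K ≤ m + j) : Qinv H K (m + 1) (j + 1) = 0 := by
  induction m generalizing j with
  | zero => rw [Qinv_one, Ico_eq_empty (by omega), sum_empty]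
  | succ m ih =>
    rw [Qinv_succ]
    refine sum_eq_zero fun i hi => ?_
    rw [mem_Ico] at hi
    rw [sum_eq_zero, mul_zero]
    intro l hl
    rw [mem_Ico] at hl
    exact ih (by omega)

section CertificatePolynomials

open Polynomial

/-- Response of the last iterate to a unit forcing through column `j + 1` of `H`. -/
noncomputable def columnPoly (H : ℕ → ℕ → ℝ) (K j : ℕ) : ℝ[X] :=
  ∑ m ∈ range (K + 1), C ((-1) ^ m * Qinv H K (m + 1) (j + 1)) * (1 - X) ^ m

/-- Response of the last iterate to a unit forcing of the `k`-th iterate. -/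
noncomputable def tailPoly (H : ℕ → ℕ → ℝ) (K k : ℕ) : ℝ[X] :=
  1 - (1 - X) * ∑ l ∈ Ico k K, columnPoly H K l

/-- Iterates of the H-matrix algorithm for multiplication by `X`, started at `c`, with forcing
`f`. -/
noncomputable def iterPoly (H : ℕ → ℕ → ℝ) (c : ℝ[X]) (f : ℕ → ℝ[X]) : ℕ → ℝ[X]
  | 0 => c
  | k + 1 => iterPoly H c f k -
      (1 - X) * (∑ j : Fin (k + 1), C (H (k + 1) (j + 1)) * iterPoly H c f j) + f k

lemma iterPoly_succ (H : ℕ → ℕ → ℝ) (c : ℝ[X]) (f : ℕ → ℝ[X]) (k : ℕ) :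
    iterPoly H c f (k + 1) = iterPoly H c f k -
      (1 - X) * (∑ j ∈ range (k + 1), C (H (k + 1) (j + 1)) * iterPoly H c f j) + f k := by
  rw [iterPoly, Fin.sum_univ_eq_sum_range fun j => C (H (k + 1) (j + 1)) * iterPoly H c f j]

lemma columnPoly_eq_sum_tailPoly (H : ℕ → ℕ → ℝ) (K j : ℕ) :
    columnPoly H K j = ∑ i ∈ Ico j K, C (H (i + 1) (j + 1)) * tailPoly H K (i + 1) := by
  have hcol (l : ℕ) : columnPoly H K l =
      ∑ m ∈ range K, C ((-1) ^ m * Qinv H K (m + 1) (l + 1)) * (1 - X) ^ m := by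
    rw [columnPoly, sum_range_succ, Qinv_eq_zero H (by omega)]
    simp
  rw [columnPoly, sum_range_succ', Qinv_one]
  simp_rw [tailPoly, hcol, Qinv_succ, mul_sub, sum_sub_distrib]
  simp only [pow_zero, one_mul, mul_one, map_sum]
  rw [add_comm, sub_eq_add_neg (∑ i ∈ Ico j K, C (H (i + 1) (j + 1))), ← sum_neg_distrib]
  congr 1
  simp_rw [map_mul, map_sum, mul_sum, sum_mul]
  rw [sum_comm]
  refine sum_congr rfl fun i _ => ?_
  simp_rw [map_sum, mul_sum, sum_mul]
  rw [sum_comm, ← sum_neg_distrib]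
  refine sum_congr rfl fun l _ => ?_
  rw [← sum_neg_distrib]
  refine sum_congr rfl fun m _ => ?_
  simp only [map_mul, pow_succ, map_pow, map_neg, map_one]
  ring

lemma tailPoly_self (H : ℕ → ℕ → ℝ) (K : ℕ) : tailPoly H K K = 1 := by
  simp [tailPoly]

lemma tailPoly_succ_sub (H : ℕ → ℕ → ℝ) {K k : ℕ} (hk : k < K) :
    tailPoly H K (k + 1) - tailPoly H K k = (1 - X) * columnPoly H K k := by
  rw [tailPoly, tailPoly, sum_eq_sum_Ico_succ_bot hk]
  ring

lemma iterPoly_last (H : ℕ → ℕ → ℝ) (c : ℝ[X]) (f : ℕ → ℝ[X]) (K : ℕ) :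
    iterPoly H c f K = tailPoly H K 0 * c + ∑ k ∈ range K, tailPoly H K (k + 1) * f k := by
  have htel := sum_range_sub (fun k => tailPoly H K k * iterPoly H c f k) K
  have hstep : ∀ k ∈ range K, tailPoly H K (k + 1) * iterPoly H c f (k + 1) -
      tailPoly H K k * iterPoly H c f k = tailPoly H K (k + 1) * f k +
      ((∑ i ∈ Ico k K, (1 - X) * C (H (i + 1) (k + 1)) * tailPoly H K (i + 1) *
          iterPoly H c f k) -
        ∑ j ∈ range (k + 1), (1 - X) * C (H (k + 1) (j + 1)) * tailPoly H K (k + 1) *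
          iterPoly H c f j) := by
    intro k hk
    have h1 := tailPoly_succ_sub H (mem_range.1 hk)
    rw [columnPoly_eq_sum_tailPoly] at h1
    have h2 : (∑ i ∈ Ico k K, (1 - X) * C (H (i + 1) (k + 1)) * tailPoly H K (i + 1) *
          iterPoly H c f k) = (1 - X) * (∑ i ∈ Ico k K, C (H (i + 1) (k + 1)) *
            tailPoly H K (i + 1)) * iterPoly H c f k := by
      simp only [mul_sum, sum_mul, mul_assoc]
    have h3 : (∑ j ∈ range (k + 1), (1 - X) * C (H (k + 1) (j + 1)) * tailPoly H K (k + 1) *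
          iterPoly H c f j) = (1 - X) * tailPoly H K (k + 1) *
            ∑ j ∈ range (k + 1), C (H (k + 1) (j + 1)) * iterPoly H c f j := by
      simp only [mul_sum]
      exact sum_congr rfl fun _ _ => by ring
    rw [h2, h3, ← h1, iterPoly_succ]
    ring
  rw [sum_congr rfl hstep, sum_add_distrib, sum_sub_distrib,
    sum_comm' (t' := range K) (s' := fun i => range (i + 1)), sub_self, add_zero, tailPoly_self,
    one_mul, iterPoly] at htel
  · rw [htel]; ring
  · intro x y
    simp only [mem_range, mem_Ico]
    omega

lemma natDegree_iterPoly_le (H : ℕ → ℕ → ℝ) (k : ℕ) : (iterPoly H 1 0 k).natDegree ≤ k := by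
  induction k using Nat.strong_induction_on with
  | _ k ih =>
  cases k with
  | zero => simp [iterPoly]
  | succ k =>
    rw [iterPoly_succ, Pi.zero_apply, add_zero]
    refine (natDegree_sub_le _ _).trans (max_le ((ih k (by omega)).trans (by omega)) ?_)
    refine (natDegree_mul_le_of_le (m := 1) (n := k) (by compute_degree)
      (natDegree_sum_le_of_forall_le _ _ ?_)).trans (add_comm 1 k).le
    intro j hj
    rw [mem_range] at hj
    exact (natDegree_C_mul_le _ _).trans ((ih j hj).trans (by omega))

lemma coeff_iterPoly (H : ℕ → ℕ → ℝ) (k : ℕ) :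
    (iterPoly H 1 0 k).coeff k = ∏ i ∈ range k, H (i + 1) (i + 1) := by
  have hlt {i k : ℕ} (h : i < k) : (iterPoly H 1 0 i).coeff k = 0 :=
    coeff_eq_zero_of_natDegree_lt ((natDegree_iterPoly_le H i).trans_lt h)
  induction k with
  | zero => simp [iterPoly]
  | succ k ih =>
    rw [iterPoly_succ, Pi.zero_apply, add_zero, coeff_sub, hlt (by omega), sub_mul, one_mul,
      coeff_sub, coeff_X_mul, finsetSum_coeff, finsetSum_coeff, sum_eq_zero, sum_range_succ,
      sum_eq_zero, prod_range_succ, ← ih]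
    · simp [mul_comm]
    · intro i hi
      rw [coeff_C_mul, hlt (mem_range.1 hi), mul_zero]
    · intro i hi
      rw [coeff_C_mul, hlt (mem_range.1 hi), mul_zero]

lemma eval_one_iterPoly (H : ℕ → ℕ → ℝ) (k : ℕ) : (iterPoly H 1 0 k).eval 1 = 1 := by
  induction k with
  | zero => simp [iterPoly]
  | succ k ih => simp [iterPoly_succ, ih]

lemma iterPoly_zero_eq_zero (H : ℕ → ℕ → ℝ) (f : ℕ → ℝ[X]) {j : ℕ} (hf : ∀ k < j, f k = 0)
    {k : ℕ} (hk : k ≤ j) : iterPoly H 0 f k = 0 := by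
  induction k using Nat.strong_induction_on with
  | _ k ih =>
  cases k with
  | zero => rw [iterPoly]
  | succ k =>
    rw [iterPoly_succ, ih k (by omega) (by omega), hf k hk, sum_eq_zero]
    · simp
    · intro i hi
      rw [mem_range] at hi
      rw [ih i hi (by omega), mul_zero]

lemma natDegree_one_sub_X_le : (1 - X : ℝ[X]).natDegree ≤ 1 := by compute_degree

lemma natDegree_tailPoly_le (H : ℕ → ℕ → ℝ) (K k : ℕ) :
    (tailPoly H K k).natDegree ≤ K - k := by
  rw [tailPoly]
  refine (natDegree_sub_le _ _).trans (max_le (by simp) ?_)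
  rw [mul_sum]
  refine natDegree_sum_le_of_forall_le _ _ fun l hl => ?_
  rw [mem_Ico] at hl
  rw [columnPoly, mul_sum]
  refine natDegree_sum_le_of_forall_le _ _ fun m _ => ?_
  by_cases hm : K ≤ m + l
  · simp [Qinv_eq_zero H hm]
  · rw [mul_left_comm, ← pow_succ']
    refine (natDegree_C_mul_le _ _).trans ((natDegree_pow_le_of_le (m + 1)
      natDegree_one_sub_X_le).trans (by omega))

lemma one_sub_X_mul_tailPoly_zero (H : ℕ → ℕ → ℝ) (K : ℕ)
    (hinv : ∀ m, 1 ≤ m → m ≤ K →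
      Pinv H K m = 1 / ((K + 1 : ℕ) : ℝ) * (Nat.choose (K + 1) (m + 1) : ℝ)) :
    C ((K + 1 : ℕ) : ℝ) * ((1 - X) * tailPoly H K 0) = 1 - X ^ (K + 1) := by
  have hP : ∀ m ∈ range (K + 1), ∑ l ∈ range K, Qinv H K (m + 1) (l + 1) =
      1 / ((K + 1 : ℕ) : ℝ) * (Nat.choose (K + 1) (m + 2) : ℝ) := by
    intro m hm
    rw [← Pinv_succ]
    rcases Nat.lt_succ_iff_lt_or_eq.1 (mem_range.1 hm) with h | rfl
    · exact hinv _ (by omega) (by omega)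
    · rw [Pinv_succ, Nat.choose_succ_self, Nat.cast_zero, mul_zero]
      exact sum_eq_zero fun l _ => Qinv_eq_zero H (by omega)
  have hbin : (X : ℝ[X]) ^ (K + 1) = 1 - C ((K + 1 : ℕ) : ℝ) * (1 - X) +
      ∑ m ∈ range (K + 1), C ((-1) ^ m * (Nat.choose (K + 1) (m + 2) : ℝ)) * (1 - X) ^ (m + 2) := by
    have h := add_pow (-(1 - X) : ℝ[X]) 1 (K + 1)
    have h0 : ∑ m ∈ range (K + 1 + 1), (-(1 - X) : ℝ[X]) ^ m * 1 ^ (K + 1 - m) *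
        ((K + 1).choose m : ℝ[X]) = ∑ m ∈ range (K + 1 + 1 + 1), (-(1 - X) : ℝ[X]) ^ m *
        ((K + 1).choose m : ℝ[X]) := by
      rw [sum_range_succ _ (K + 1 + 1), Nat.choose_succ_self]
      simp
    rw [h0, sum_range_succ', sum_range_succ'] at h
    rw [show (X : ℝ[X]) = -(1 - X) + 1 by ring, h]
    have h2 : ∀ m ∈ range (K + 1), (-(1 - X) : ℝ[X]) ^ (m + 1 + 1) *
        ((K + 1).choose (m + 1 + 1) : ℝ[X]) =
        C ((-1) ^ m * (Nat.choose (K + 1) (m + 2) : ℝ)) * (1 - X) ^ (m + 2) := by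
      intro m _
      rw [neg_pow]
      simp only [map_mul, map_pow, map_neg, map_one, map_natCast]
      ring
    rw [sum_congr rfl h2]
    simp only [map_natCast]
    push_cast
    simp
    ring
  have htail : C ((K + 1 : ℕ) : ℝ) * (∑ l ∈ range K, columnPoly H K l) =
      ∑ m ∈ range (K + 1), C ((-1) ^ m * (Nat.choose (K + 1) (m + 2) : ℝ)) * (1 - X) ^ m := by
    simp_rw [columnPoly]
    rw [sum_comm, mul_sum]
    refine sum_congr rfl fun m hm => ?_
    rw [← sum_mul, ← map_sum, ← mul_sum, hP m hm, ← mul_assoc, ← C_mul]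
    congr 2
    field_simp
  rw [hbin, tailPoly, Nat.Ico_zero_eq_range]
  rw [show ∀ a b s : ℝ[X], a * (b * (1 - b * s)) = a * b - b ^ 2 * (a * s) by intros; ring, htail,
    mul_sum, sub_add_eq_sub_sub, sub_sub_cancel]
  congr 1
  exact sum_congr rfl fun m _ => by ring

lemma tailPoly_zero (H : ℕ → ℕ → ℝ) (K : ℕ)
    (hinv : ∀ m, 1 ≤ m → m ≤ K →
      Pinv H K m = 1 / ((K + 1 : ℕ) : ℝ) * (Nat.choose (K + 1) (m + 1) : ℝ)) :
    C ((K + 1 : ℕ) : ℝ) * tailPoly H K 0 = ∑ i ∈ range (K + 1), X ^ i := by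
  have h1 : (1 - X : ℝ[X]) ≠ 0 := fun h => by simpa using congrArg (eval 0) h
  refine mul_left_cancel₀ h1 ?_
  rw [mul_left_comm, one_sub_X_mul_tailPoly_zero H K hinv, mul_neg_geom_sum]

end CertificatePolynomials

section Negacyclic

open Polynomial

variable {E : Type*} [NormedAddCommGroup E] [InnerProductSpace ℝ E]

/-- Evaluation of a polynomial at a linear isometry. -/
noncomputable def isoEval (U : E ≃ₗᵢ[ℝ] E) : ℝ[X] →ₐ[ℝ] Module.End ℝ E :=
  aeval (U.toLinearEquiv : E →ₗ[ℝ] E)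

/-- `U` acts on the orbit of the unit vector `e` as the negacyclic shift of an orthonormal family of
`N` vectors. -/
structure IsNegacyclic (N : ℕ) (U : E ≃ₗᵢ[ℝ] E) (e : E) : Prop where
  norm_eq : ‖e‖ = 1
  pow_eq : isoEval U (X ^ N) e = -e
  inner_eq : ∀ n, 0 < n → n < N → inner ℝ e (isoEval U (X ^ n) e) = 0

lemma isoEval_X (U : E ≃ₗᵢ[ℝ] E) (x : E) : isoEval U X x = U x := by
  simp [isoEval]

lemma isoEval_C (U : E ≃ₗᵢ[ℝ] E) (c : ℝ) (x : E) : isoEval U (C c) x = c • x := by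
  simp [isoEval, Module.algebraMap_end_apply]

lemma isoEval_mul (U : E ≃ₗᵢ[ℝ] E) (f g : ℝ[X]) (x : E) :
    isoEval U (f * g) x = isoEval U f (isoEval U g x) := by
  rw [map_mul, Module.End.mul_apply]

lemma inner_isoEval_symm (U : E ≃ₗᵢ[ℝ] E) (f : ℝ[X]) (x y : E) :
    inner ℝ (isoEval U.symm f x) y = inner ℝ x (isoEval U f y) := by
  induction f using Polynomial.induction_on generalizing x y with
  | C a => simp [isoEval_C, inner_smul_left, inner_smul_right]
  | add p q hp hq => simp [inner_add_left, inner_add_right, hp, hq]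
  | monomial n a h =>
    rw [pow_succ, ← mul_assoc, isoEval_mul, h, isoEval_X, mul_comm _ X, isoEval_mul U X, isoEval_X,
      ← U.inner_map_map, U.apply_symm_apply]

lemma inner_isoEval_pow (U : E ≃ₗᵢ[ℝ] E) (n : ℕ) (x y : E) :
    inner ℝ (isoEval U (X ^ n) x) (isoEval U (X ^ n) y) = inner ℝ x y := by
  induction n with
  | zero => simp
  | succ n ih => rw [pow_succ', isoEval_mul, isoEval_mul, isoEval_X, isoEval_X, U.inner_map_map, ih]

namespace IsNegacyclic

variable {N : ℕ} {U : E ≃ₗᵢ[ℝ] E} {e : E}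

lemma inner_pow_of_lt (h : IsNegacyclic N U e) {n : ℕ} (hn : n < N) :
    inner ℝ e (isoEval U (X ^ n) e) = if n = 0 then 1 else 0 := by
  split_ifs with h0
  · subst h0; simp [h.norm_eq]
  · exact h.inner_eq n (by omega) hn

lemma inner_pow_add (h : IsNegacyclic N U e) {n : ℕ} (hn : n < N) :
    inner ℝ e (isoEval U (X ^ (n + N)) e) = if n = 0 then -1 else 0 := by
  rw [pow_add, isoEval_mul, h.pow_eq, map_neg, inner_neg_right, h.inner_pow_of_lt hn]
  split_ifs <;> simp

lemma inner_X_mul_eq_zero (h : IsNegacyclic N U e) {f : ℝ[X]} (hf : f.natDegree + 1 < N) :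
    inner ℝ e (isoEval U (X * f) e) = 0 := by
  rw [f.as_sum_range_C_mul_X_pow, mul_sum, map_sum, LinearMap.sum_apply, inner_sum]
  refine sum_eq_zero fun i hi => ?_
  rw [mem_range] at hi
  rw [mul_left_comm, ← pow_succ', isoEval_mul, isoEval_C, inner_smul_right,
    h.inner_pow_of_lt (by omega), if_neg (by omega), mul_zero]

lemma inner_X_mul_geom_sum_mul (h : IsNegacyclic N U e) {f : ℝ[X]} (hf : f.natDegree < N) :
    inner ℝ e (isoEval U (X * ((∑ i ∈ range N, X ^ i) * f)) e) = -f.eval 1 := by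
  have hmono : ∀ t < N, inner ℝ e (isoEval U (X * ((∑ i ∈ range N, X ^ i) * X ^ t)) e) = -1 := by
    intro t ht
    rw [sum_mul, mul_sum, map_sum, LinearMap.sum_apply, inner_sum,
      sum_eq_single_of_mem (N - 1 - t) (mem_range.2 (by omega))]
    · rw [← pow_add, ← pow_succ', show N - 1 - t + t + 1 = 0 + N by omega, h.inner_pow_add (by omega),
        if_pos rfl]
    · intro i hi hne
      rw [mem_range] at hi
      rw [← pow_add, ← pow_succ']
      rcases lt_or_ge (i + t + 1) N with hlt | hge
      · rw [h.inner_pow_of_lt hlt, if_neg (by omega)]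
      · obtain ⟨n, hn⟩ := Nat.exists_eq_add_of_le' hge
        rw [hn, h.inner_pow_add (by omega), if_neg (by omega)]
  rw [f.as_sum_range_C_mul_X_pow, mul_sum, mul_sum, map_sum, LinearMap.sum_apply, inner_sum,
    eval_finsetSum, ← sum_neg_distrib]
  refine sum_congr rfl fun t ht => ?_
  rw [mem_range] at ht
  rw [mul_left_comm _ (C _), mul_left_comm _ (C _), isoEval_mul, isoEval_C, inner_smul_right,
    hmono t (by omega)]
  simp

lemma inner_symm_pow (h : IsNegacyclic N U e) {a b : ℕ} (ha : a < N) (hb : b < N) :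
    inner ℝ (isoEval U.symm (X ^ a) e) (isoEval U.symm (X ^ b) e) = if a = b then 1 else 0 := by
  wlog hab : a ≤ b generalizing a b
  · rw [real_inner_comm, this hb ha (by omega)]
    exact if_congr eq_comm rfl rfl
  obtain ⟨c, rfl⟩ := Nat.exists_eq_add_of_le hab
  rw [pow_add, isoEval_mul, inner_isoEval_pow, real_inner_comm, inner_isoEval_symm,
    h.inner_pow_of_lt (by omega)]
  exact if_congr (by omega) rfl rfl

lemma inner_symm_isoEval (h : IsNegacyclic N U e) {f g : ℝ[X]} (hf : f.natDegree < N)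
    (hg : g.natDegree < N) :
    inner ℝ (isoEval U.symm f e) (isoEval U.symm g e) =
      ∑ t ∈ range N, f.coeff t * g.coeff t := by
  conv_lhs => rw [f.as_sum_range_C_mul_X_pow' hf, g.as_sum_range_C_mul_X_pow' hg]
  rw [map_sum, LinearMap.sum_apply, sum_inner]
  refine sum_congr rfl fun t ht => ?_
  rw [map_sum, LinearMap.sum_apply, inner_sum, sum_eq_single_of_mem t ht]
  · rw [isoEval_mul, isoEval_mul, isoEval_C, isoEval_C, inner_smul_right, inner_smul_left,
      h.inner_symm_pow (mem_range.1 ht) (mem_range.1 ht), if_pos rfl]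
    simp [mul_comm]
  · intro b hb hne
    rw [isoEval_mul, isoEval_mul, isoEval_C, isoEval_C, inner_smul_right, inner_smul_left,
      h.inner_symm_pow (mem_range.1 ht) (mem_range.1 hb), if_neg hne.symm]
    simp

lemma inner_symm_one_sub_X_pow (h : IsNegacyclic N U e) {m l : ℕ} (hm : m < N) (hl : l < N) :
    inner ℝ (isoEval U.symm ((1 - X) ^ l) e) (isoEval U.symm ((1 - X) ^ m) e) =
      (Nat.choose (l + m) m : ℝ) := by
  have hdeg (k : ℕ) : ((1 - X : ℝ[X]) ^ k).natDegree ≤ k :=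
    (natDegree_pow_le_of_le k natDegree_one_sub_X_le).trans (by omega)
  have hcoeff (k t : ℕ) : ((1 - X : ℝ[X]) ^ k).coeff t = (-1) ^ t * (k.choose t : ℝ) := by
    rw [show ((1 - X : ℝ[X]) ^ k) = ((1 + X) ^ k : ℝ[X]).comp (C (-1) * X) by simp [sub_eq_add_neg],
      comp_C_mul_X_coeff, coeff_one_add_X_pow, mul_comm]
  rw [h.inner_symm_isoEval ((hdeg l).trans_lt hl) ((hdeg m).trans_lt hm), Nat.add_choose_eq,
    Nat.sum_antidiagonal_eq_sum_range_succ_mk]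
  push_cast
  rw [← sum_subset (range_subset_range.2 (Nat.succ_le_of_lt hm))]
  · refine sum_congr rfl fun t ht => ?_
    rw [hcoeff, hcoeff, Nat.choose_symm (by simpa [Nat.lt_succ_iff] using ht)]
    have := pow_mul_pow_eq_one t (show (-1 : ℝ) * (-1) = 1 by norm_num)
    linear_combination (l.choose t * m.choose t : ℝ) * this
  · intro t _ ht
    rw [hcoeff m, Nat.choose_eq_zero_of_lt (by simpa using ht)]
    simp

end IsNegacyclic

/-- The coupled two-sided recurrence `hrec`, with these boundary values, forces `M` to be constant
on and above the diagonal. -/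
lemma pairing_eq_ite {K : ℕ} {c : ℝ} {h M : ℕ → ℕ → ℝ} (hdiag : ∀ k < K, h (k + 1) (k + 1) ≠ 0)
    (hlow : ∀ k ≤ K, ∀ l < k, M k l = 0) (hzero : ∀ l ≤ K, M 0 l = -c)
    (hrec : ∀ k < K, ∀ l < K,
      ∑ r ∈ range (l + 1), h (l + 1) (r + 1) * (M (k + 1) r - M k r) =
        -∑ r ∈ Ico k K, h (r + 1) (k + 1) * (M (r + 1) (l + 1) - M (r + 1) l)) :
    ∀ k ≤ K, ∀ l ≤ K, M k l = if k ≤ l then -c else 0 := by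
  have key : ∀ d k, k + d ≤ K → M k (k + d) = -c := by
    intro d
    induction d using Nat.strong_induction_on with
    | _ d ihd =>
    intro k
    induction k with
    | zero => intro hk; exact hzero _ hk
    | succ k ihk =>
      intro hk
      have hM {a b : ℕ} (ha : a ≤ K) (hb : b ≤ K) (hab : b < a + d ∨ b = k + d ∧ a = k) :
          M a b = if a ≤ b then -c else 0 := by
        split_ifs with hle
        · obtain ⟨n, rfl⟩ := Nat.exists_eq_add_of_le hle
          rcases hab with hab | ⟨hb', rfl⟩
          · exact ihd n (by omega) a hb
          · rw [hb']; exact ihk (by omega)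
        · exact hlow a ha b (by omega)
      have hr := hrec k (by omega) (k + d) (by omega)
      have hL : ∑ r ∈ range (k + d + 1), h (k + d + 1) (r + 1) * (M (k + 1) r - M k r) =
          h (k + d + 1) (k + 1) * c := by
        rw [sum_eq_single_of_mem k (mem_range.2 (by omega))]
        · rw [hlow (k + 1) (by omega) k (by omega), hM (by omega) (by omega) (by omega), if_pos le_rfl]
          ring
        · intro r hr hne
          rw [mem_range] at hr
          rw [hM (by omega) (by omega) (by omega), hM (by omega) (by omega) (by omega),
            if_congr (show k + 1 ≤ r ↔ k ≤ r by omega) rfl rfl, sub_self, mul_zero]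
      have hR : ∑ r ∈ Ico (k + 1) K, h (r + 1) (k + 1) *
          (M (r + 1) (k + d + 1) - M (r + 1) (k + d)) =
          -(if d = 0 then 0 else h (k + d + 1) (k + 1) * c) := by
        have hM' : ∀ r ∈ Ico (k + 1) K, h (r + 1) (k + 1) *
            (M (r + 1) (k + d + 1) - M (r + 1) (k + d)) =
            if r = k + d then -(h (r + 1) (k + 1) * c) else 0 := by
          intro r hr
          rw [mem_Ico] at hr
          rw [hM (by omega) (by omega) (by omega), hM (by omega) (by omega) (by omega)]
          split_ifs <;> first | omega | ring
        rw [sum_congr rfl hM', sum_ite_eq']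
        split_ifs with h1 h2 h2 <;> simp only [mem_Ico] at h1 <;> first | omega | simp
      rw [hL, sum_eq_sum_Ico_succ_bot (by omega), hR, hM (a := k + 1) (b := k + d) (by omega)
        (by omega) (by omega)] at hr
      rw [show k + 1 + d = k + d + 1 by ring]
      refine mul_left_cancel₀ (hdiag k (by omega)) ?_
      by_cases hd : d = 0
      · subst hd
        rw [if_pos rfl, if_neg (by omega)] at hr
        simp only [add_zero] at hr ⊢
        linarith
      · rw [if_neg hd, if_pos (by omega)] at hr
        linarith
  intro k hk l hl
  split_ifs with hkl
  · obtain ⟨d, rfl⟩ := Nat.exists_eq_add_of_le hkl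
    exact key d k hl
  · exact hlow k hk l (by omega)

lemma diag_ne_zero (H : ℕ → ℕ → ℝ) (K : ℕ)
    (hinv : ∀ m, 1 ≤ m → m ≤ K →
      Pinv H K m = 1 / ((K + 1 : ℕ) : ℝ) * (Nat.choose (K + 1) (m + 1) : ℝ)) :
    ∀ k < K, H (k + 1) (k + 1) ≠ 0 := by
  have h := congrArg (fun f => coeff f K) (tailPoly_zero H K hinv)
  have hlast := iterPoly_last H 1 0 K
  simp only [Pi.zero_apply, mul_zero, sum_const_zero, add_zero, mul_one] at hlast
  simp only [← hlast, coeff_C_mul, coeff_iterPoly, finsetSum_coeff, coeff_X_pow, sum_ite_eq,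
    mem_range, Nat.lt_succ_self, if_true] at h
  intro k hk h0
  rw [prod_eq_zero (mem_range.2 hk) h0, mul_zero] at h
  exact zero_ne_one h

/-- Generating polynomial of the certificates attached to index `k + 1`. -/
noncomputable def certPoly (H : ℕ → ℕ → ℝ) (K k : ℕ) : ℝ[X] :=
  if k = K then -1 else (1 - X) * columnPoly H K k

namespace IsNegacyclic

variable {K : ℕ} {U : E ≃ₗᵢ[ℝ] E} {e : E} {H : ℕ → ℕ → ℝ}

lemma inner_tailPoly_mul_iterPoly (h : IsNegacyclic (K + 1) U e)
    (hinv : ∀ m, 1 ≤ m → m ≤ K →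
      Pinv H K m = 1 / ((K + 1 : ℕ) : ℝ) * (Nat.choose (K + 1) (m + 1) : ℝ)) :
    ∀ k ≤ K, ∀ l ≤ K, inner ℝ e (isoEval U (X * (tailPoly H K k * iterPoly H 1 0 l)) e) =
      if k ≤ l then -(1 / ((K + 1 : ℕ) : ℝ)) else 0 := by
  set φ : ℝ[X] →ₗ[ℝ] ℝ :=
    { toFun := fun f => inner ℝ e (isoEval U (X * f) e)
      map_add' := fun f g => by simp [mul_add, inner_add_right]
      map_smul' := fun c f => by simp [inner_smul_right] } with hφ
  have hφC (c : ℝ) (f : ℝ[X]) : φ (C c * f) = c * φ f := by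
    rw [← smul_eq_C_mul, map_smul, smul_eq_mul]
  refine pairing_eq_ite (M := fun k l => φ (tailPoly H K k * iterPoly H 1 0 l))
    (diag_ne_zero H K hinv) ?_ ?_ ?_
  · intro k hk l hl
    refine h.inner_X_mul_eq_zero (Nat.succ_lt_succ ?_)
    exact (natDegree_mul_le_of_le (natDegree_tailPoly_le H K k)
      (natDegree_iterPoly_le H l)).trans_lt (by omega)
  · intro l hl
    have h1 := h.inner_X_mul_geom_sum_mul
      (Nat.lt_succ_of_le ((natDegree_iterPoly_le H l).trans hl))
    rw [← tailPoly_zero H K hinv, eval_one_iterPoly, mul_assoc] at h1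
    have h2 := hφC ((K + 1 : ℕ) : ℝ) (tailPoly H K 0 * iterPoly H 1 0 l)
    have h3 : ((K + 1 : ℕ) : ℝ) ≠ 0 := by positivity
    refine mul_left_cancel₀ h3 (h2.symm.trans (h1.trans ?_))
    field_simp
  · intro k hk l hl
    simp only [← map_sub, ← sub_mul, ← mul_sub, ← hφC, ← map_sum, ← map_neg]
    congr 1
    rw [tailPoly_succ_sub H hk, iterPoly_succ, columnPoly_eq_sum_tailPoly]
    rw [Pi.zero_apply, add_zero, sub_sub_cancel_left]
    set A := ∑ i ∈ Ico k K, C (H (i + 1) (k + 1)) * tailPoly H K (i + 1)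
    set B := ∑ j ∈ range (l + 1), C (H (l + 1) (j + 1)) * iterPoly H 1 0 j
    trans (1 - X) * A * B
    · simp only [B, mul_sum]
      exact sum_congr rfl fun _ _ => by ring
    · simp only [A, sum_mul, mul_sum, ← sum_neg_distrib]
      exact sum_congr rfl fun _ _ => by ring

lemma inner_certPoly_mul_iterPoly (h : IsNegacyclic (K + 1) U e)
    (hinv : ∀ m, 1 ≤ m → m ≤ K →
      Pinv H K m = 1 / ((K + 1 : ℕ) : ℝ) * (Nat.choose (K + 1) (m + 1) : ℝ)) {k l : ℕ}
    (hk : k ≤ K) (hl : l ≤ K) :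
    inner ℝ e (isoEval U (X * (certPoly H K k * iterPoly H 1 0 l)) e) =
      if k = l then 1 / ((K + 1 : ℕ) : ℝ) else 0 := by
  have hM := h.inner_tailPoly_mul_iterPoly hinv
  rw [certPoly]
  split_ifs with hkK hkl hkl
  · have := hM K le_rfl l hl
    rw [tailPoly_self, one_mul, if_pos (by omega)] at this
    rw [neg_one_mul, mul_neg, map_neg, LinearMap.neg_apply, inner_neg_right, this, neg_neg]
  · have := hM K le_rfl l hl
    rw [tailPoly_self, one_mul, if_neg (by omega)] at this
    rw [neg_one_mul, mul_neg, map_neg, LinearMap.neg_apply, inner_neg_right, this, neg_zero]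
  all_goals
    rw [← tailPoly_succ_sub H (by omega), sub_mul, mul_sub, map_sub, LinearMap.sub_apply,
      inner_sub_right, hM (k + 1) (by omega) l hl, hM k hk l hl]
    split_ifs <;> first | omega | simp

lemma lamStar_eq (h : IsNegacyclic (K + 1) U e) {i j : ℕ} (hji : j < i) (hi : i ≤ K) :
    lamStar (K + 1) H (i + 1) (j + 1) = -((K + 1 : ℕ) : ℝ) *
      inner ℝ (isoEval U.symm (certPoly H K j) e) (isoEval U.symm (certPoly H K i) e) := by
  have hIcc (l : ℕ) (F : ℕ → ℝ) (hF : ∀ m, K ≤ m + l → F (m + 1) = 0) :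
      ∑ m ∈ Icc 1 (K + 1 - (l + 1)), F m = ∑ m ∈ range K, F (m + 1) := by
    rw [← sum_subset (range_subset_range.2 (Nat.sub_le K l)), range_eq_Ico, sum_Ico_add' F 0 _ 1]
    · refine sum_congr ?_ fun _ _ => rfl
      ext m
      simp only [mem_Icc, mem_Ico]
      omega
    · intro m _ hm
      rw [mem_range] at hm
      exact hF m (by omega)
  have hcert {k : ℕ} (hk : k < K) : isoEval U.symm (certPoly H K k) e =
      ∑ m ∈ range K, ((-1) ^ m * Qinv H K (m + 1) (k + 1)) •
        isoEval U.symm ((1 - X) ^ (m + 1)) e := by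
    rw [certPoly, if_neg hk.ne, columnPoly, sum_range_succ, Qinv_eq_zero H (by omega), mul_zero,
      map_zero, zero_mul, add_zero, mul_sum, map_sum, LinearMap.sum_apply]
    refine sum_congr rfl fun m _ => ?_
    rw [mul_left_comm, ← pow_succ', isoEval_mul, isoEval_C]
  rw [lamStar, neg_mul_comm, hcert (by omega)]
  by_cases hiK : i = K
  · rw [if_pos (by omega), certPoly, if_pos hiK, map_neg, LinearMap.neg_apply, inner_neg_right,
      neg_neg, hIcc, sum_inner]
    · congr 1
      refine sum_congr rfl fun m hm => ?_
      have := h.inner_symm_one_sub_X_pow (m := 0) (l := m + 1) (by omega)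
        (Nat.succ_lt_succ (mem_range.1 hm))
      rw [pow_zero] at this
      rw [inner_smul_left, this]
      simp
    · intro m hm
      simp [Qinv_eq_zero H hm]
  · rw [if_neg (by omega), hcert (by omega), sum_inner, hIcc, ← sum_neg_distrib]
    · congr 1
      refine sum_congr rfl fun l hl => ?_
      rw [inner_sum, hIcc, ← sum_neg_distrib]
      · refine sum_congr rfl fun m hm => ?_
        rw [inner_smul_left, inner_smul_right, h.inner_symm_one_sub_X_pow
          (Nat.succ_lt_succ (mem_range.1 hm)) (Nat.succ_lt_succ (mem_range.1 hl)),
          show l + 1 + (m + 1) - 1 = l + m + 1 by omega]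
        simp
        ring
      · intro m hm
        simp [Qinv_eq_zero H hm]
    · intro m hm
      simp [Qinv_eq_zero H hm]

end IsNegacyclic


lemma exists_isNegacyclic (K : ℕ) :
    ∃ (U : EuclideanSpace ℝ (Fin (K + 1 + 1)) ≃ₗᵢ[ℝ] EuclideanSpace ℝ (Fin (K + 1 + 1))) (e : _),
      IsNegacyclic (K + 1) U e := by
  let σ : Equiv.Perm (Fin (K + 1 + 1)) := Fin.cycleRange ⟨K, by omega⟩
  let P : EuclideanSpace ℝ (Fin (K + 1 + 1)) ≃ₗᵢ[ℝ] EuclideanSpace ℝ (Fin (K + 1 + 1)) :=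
    LinearIsometryEquiv.piLpCongrLeft 2 ℝ ℝ σ
  let D : EuclideanSpace ℝ (Fin (K + 1 + 1)) ≃ₗᵢ[ℝ] EuclideanSpace ℝ (Fin (K + 1 + 1)) :=
    LinearIsometryEquiv.piLpCongrRight 2 fun i => if i = 0 then LinearIsometryEquiv.neg ℝ
      else LinearIsometryEquiv.refl ℝ ℝ
  have hP (i : Fin (K + 1 + 1)) : P (EuclideanSpace.single i 1) = EuclideanSpace.single (σ i) 1 :=
    LinearIsometryEquiv.piLpCongrLeft_single σ i 1
  have hD (i : Fin (K + 1 + 1)) : D (EuclideanSpace.single i 1) =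
      if i = 0 then -EuclideanSpace.single i 1 else EuclideanSpace.single i 1 := by
    ext k
    by_cases hi : i = 0 <;> by_cases hk : k = 0 <;> by_cases hik : k = i <;>
      simp_all [D]
  have hU (i : Fin (K + 1 + 1)) : (P.trans D) (EuclideanSpace.single i 1) =
      if σ i = 0 then -EuclideanSpace.single (σ i) 1 else EuclideanSpace.single (σ i) 1 := by
    rw [LinearIsometryEquiv.trans_apply, hP, hD]
  have hpow : ∀ n (hn : n ≤ K), isoEval (P.trans D) (X ^ n) (EuclideanSpace.single 0 1) =
      EuclideanSpace.single ⟨n, by omega⟩ 1 := by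
    intro n
    induction n with
    | zero => intro _; simp
    | succ n ih =>
      intro hn
      have hσ : σ ⟨n, by omega⟩ = ⟨n + 1, by omega⟩ :=
        Fin.ext (Fin.coe_cycleRange_of_lt (Fin.mk_lt_mk.2 hn))
      rw [pow_succ', isoEval_mul, ih (by omega), isoEval_X, hU, hσ, if_neg]
      simp [Fin.ext_iff]
  refine ⟨P.trans D, EuclideanSpace.single 0 1, by simp, ?_, ?_⟩
  · rw [pow_succ', isoEval_mul, hpow K le_rfl, isoEval_X, hU,
      show σ ⟨K, by omega⟩ = 0 from Fin.cycleRange_self _, if_pos rfl]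
  · intro n hn0 hn
    rw [hpow n (by omega), EuclideanSpace.inner_single_left]
    have : (0 : Fin (K + 1 + 1)) ≠ ⟨n, by omega⟩ := fun h => hn0.ne (Fin.ext_iff.1 h)
    simp [this]

/-- The metric projection onto the half-space `{v | τ ≤ ⟪a, v⟫}`. -/
noncomputable def halfSpaceProj (a : E) (τ : ℝ) (v : E) : E :=
  v + (max 0 (τ - inner ℝ a v) / ‖a‖ ^ 2) • a

lemma halfSpaceProj_of_le {a v : E} {τ : ℝ} (h : τ ≤ inner ℝ a v) : halfSpaceProj a τ v = v := by
  rw [halfSpaceProj, max_eq_left (by linarith)]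
  simp

lemma norm_halfSpaceProj_sub_le {a : E} (ha : a ≠ 0) (τ : ℝ) (v w : E) :
    ‖halfSpaceProj a τ v - halfSpaceProj a τ w‖ ≤ ‖v - w‖ := by
  have ha' : 0 < ‖a‖ ^ 2 := by positivity
  set s := max 0 (τ - inner ℝ a v)
  set t := max 0 (τ - inner ℝ a w)
  have hsub : halfSpaceProj a τ v - halfSpaceProj a τ w = (v - w) + ((s - t) / ‖a‖ ^ 2) • a := by
    simp only [halfSpaceProj, s, t, sub_div, sub_smul]
    abel
  refine le_of_sq_le_sq ?_ (norm_nonneg _)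
  rw [hsub, norm_add_sq_real, norm_smul, inner_smul_right, mul_pow, Real.norm_eq_abs, sq_abs,
    real_inner_comm, inner_sub_right]
  have hkey : (s - t) ^ 2 + 2 * (s - t) * (inner ℝ a v - inner ℝ a w) ≤ 0 := by
    simp only [s, t]
    rcases max_cases 0 (τ - inner ℝ a v) with ⟨h1, h1'⟩ | ⟨h1, h1'⟩ <;>
    rcases max_cases 0 (τ - inner ℝ a w) with ⟨h2, h2'⟩ | ⟨h2, h2'⟩ <;>
    rw [h1, h2] <;> nlinarith
  have : ((s - t) / ‖a‖ ^ 2) ^ 2 * ‖a‖ ^ 2 +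
      2 * ((s - t) / ‖a‖ ^ 2 * (inner ℝ a v - inner ℝ a w)) =
      ((s - t) ^ 2 + 2 * (s - t) * (inner ℝ a v - inner ℝ a w)) / ‖a‖ ^ 2 := by
    field_simp
  have := div_nonpos_of_nonpos_of_nonneg hkey ha'.le
  linarith

lemma isoEval_iterPoly_succ (U : E ≃ₗᵢ[ℝ] E) (H : ℕ → ℕ → ℝ) (c : ℝ[X]) (f : ℕ → ℝ[X]) (k : ℕ)
    (x : E) :
    isoEval U (iterPoly H c f (k + 1)) x = isoEval U (iterPoly H c f k) x -
      (∑ j ∈ range (k + 1), H (k + 1) (j + 1) • (isoEval U (iterPoly H c f j) x -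
        U (isoEval U (iterPoly H c f j) x))) + isoEval U (f k) x := by
  rw [iterPoly_succ, mul_sum, map_add, map_sub, map_sum, LinearMap.add_apply, LinearMap.sub_apply,
    LinearMap.sum_apply]
  congr 2
  refine sum_congr rfl fun j _ => ?_
  rw [mul_left_comm, isoEval_mul, isoEval_C, isoEval_mul, map_sub, LinearMap.sub_apply, isoEval_X,
    map_one, Module.End.one_apply]

/-- Composing the isometry `U` with the projection onto a suitable half-space bounded near the
`j`-th iterate makes the last residual larger than `2 / N`. -/
lemma exists_nonexpansive_of_direction {K : ℕ} {U : E ≃ₗᵢ[ℝ] E} {e : E} {H : ℕ → ℕ → ℝ}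
    (h : IsNegacyclic (K + 1) U e)
    (hinv : ∀ m, 1 ≤ m → m ≤ K →
      Pinv H K m = 1 / ((K + 1 : ℕ) : ℝ) * (Nat.choose (K + 1) (m + 1) : ℝ))
    {j : ℕ} (hj : j < K) {a : E} {η : ℝ} (ha0 : a ≠ 0) (hη : 0 < η)
    (haj : inner ℝ a (isoEval U (iterPoly H 1 0 j) e) = -η)
    (hak : ∀ k ≤ K, k ≠ j → 0 ≤ inner ℝ a (isoEval U (iterPoly H 1 0 k) e))
    (hpos : 0 < inner ℝ e (isoEval U (X * certPoly H K j) a)) :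
    ∃ (T : E → E) (y : ℕ → E), (∀ v w, ‖T v - T w‖ ≤ ‖v - w‖) ∧ T 0 = 0 ∧ y 0 = e ∧
      (∀ k, k < K →
        y (k + 1) = y k - ∑ j ∈ range (k + 1), H (k + 1) (j + 1) • (y j - T (y j))) ∧
      4 / ((K + 1 : ℕ) : ℝ) ^ 2 < ‖y K - T (y K)‖ ^ 2 := by
  set f : ℕ → ℝ[X] := fun k => if j ≤ k then C (H (k + 1) (j + 1)) else 0 with hf
  set w : ℕ → E := fun k => isoEval U (iterPoly H 0 f k) (U a) with hw
  set B : ℝ := ‖a‖ ^ 2 + ∑ k ∈ range (K + 1), |inner ℝ a (w k)| with hB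
  have ha : 0 < ‖a‖ ^ 2 := by positivity
  have hBpos : 0 < B := by positivity
  set ε : ℝ := η / B with hε
  have hεpos : 0 < ε := by positivity
  have hεB : ε * B = η := by rw [hε]; field_simp
  have hεk {k : ℕ} (hk : k ≤ K) : ε * ‖a‖ ^ 2 + ε * |inner ℝ a (w k)| ≤ η := by
    rw [← hεB, ← mul_add, hB]
    gcongr
    exact single_le_sum (f := fun k => |inner ℝ a (w k)|) (fun _ _ => abs_nonneg _)
      (mem_range.2 (Nat.lt_succ_of_le hk))
  set τ : ℝ := -η + ε * ‖a‖ ^ 2 with hτ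
  set y : ℕ → E := fun k => isoEval U (iterPoly H 1 0 k) e + ε • w k with hy
  have hwj {k : ℕ} (hk : k ≤ j) : w k = 0 := by
    simp only [hw]
    rw [iterPoly_zero_eq_zero H f (fun i hi => if_neg (by omega)) hk]
    simp
  have hT {k : ℕ} (hk : k ≤ K) : U (halfSpaceProj a τ (y k)) =
      U (y k) + if k = j then ε • U a else 0 := by
    split_ifs with hkj
    · have hyj : inner ℝ a (y k) = -η := by
        simp only [hy, hwj hkj.le, smul_zero, add_zero]
        rw [hkj, haj]
      rw [halfSpaceProj, hyj, hτ, show -η + ε * ‖a‖ ^ 2 - -η = ε * ‖a‖ ^ 2 by ring,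
        max_eq_right (by positivity), mul_div_cancel_right₀ _ ha.ne', map_add, map_smul]
    · rw [halfSpaceProj_of_le, add_zero]
      simp only [hy]
      rw [inner_add_right, inner_smul_right]
      have h1 := hεk hk
      have h2 := hak k hk hkj
      have h3 := mul_le_mul_of_nonneg_left (neg_abs_le (inner ℝ a (w k))) hεpos.le
      linarith
  refine ⟨fun v => U (halfSpaceProj a τ v), y, ?_, ?_, ?_, ?_, ?_⟩
  · intro v w
    rw [← map_sub, U.norm_map]
    exact norm_halfSpaceProj_sub_le ha0 τ v w
  · change U (halfSpaceProj a τ 0) = 0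
    rw [halfSpaceProj_of_le, map_zero]
    rw [inner_zero_right]
    have := hεk (Nat.zero_le K)
    have := mul_nonneg hεpos.le (abs_nonneg (inner ℝ a (w 0)))
    linarith
  · simp only [hy, hwj (Nat.zero_le j)]
    simp [iterPoly]
  · intro k hk
    have hsum : ∑ i ∈ range (k + 1), H (k + 1) (i + 1) •
        (y i - (U (y i) + if i = j then ε • U a else 0)) =
        ∑ i ∈ range (k + 1), H (k + 1) (i + 1) • (y i - U (y i)) - ε • isoEval U (f k) (U a) := by
      simp_rw [← sub_sub, smul_sub _ (_ - _), sum_sub_distrib]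
      congr 1
      simp only [smul_ite, smul_zero, sum_ite_eq', mem_range, hf]
      split_ifs with h1 h2 h2
      · rw [isoEval_C, smul_comm]
      · omega
      · omega
      · simp
    have hsum' : ∑ i ∈ range (k + 1), H (k + 1) (i + 1) •
        (y i - U (halfSpaceProj a τ (y i))) = ∑ i ∈ range (k + 1), H (k + 1) (i + 1) •
        (y i - (U (y i) + if i = j then ε • U a else 0)) :=
      sum_congr rfl fun i hi => by rw [hT (by rw [mem_range] at hi; omega)]
    rw [hsum', hsum]
    simp only [hy, hw]
    rw [isoEval_iterPoly_succ, isoEval_iterPoly_succ]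
    simp only [map_add, map_smul, Pi.zero_apply, map_zero, LinearMap.zero_apply, smul_sub, smul_add,
      sum_sub_distrib, sum_add_distrib, smul_sum, smul_comm ε]
    abel
  · have hlast : iterPoly H 0 f K = columnPoly H K j := by
      rw [iterPoly_last, columnPoly_eq_sum_tailPoly, mul_zero, zero_add]
      simp only [hf, mul_ite, mul_zero]
      rw [← sum_filter]
      refine sum_congr ?_ fun _ _ => mul_comm _ _
      ext i
      simp only [mem_filter, mem_range, mem_Ico]
      omega
    have hbase : iterPoly H 1 0 K = tailPoly H K 0 := by
      rw [iterPoly_last]; simp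
    have hN : ((K + 1 : ℕ) : ℝ) ≠ 0 := by positivity
    have hres : y K - U (halfSpaceProj a τ (y K)) =
        (2 / ((K + 1 : ℕ) : ℝ)) • e + ε • isoEval U (X * certPoly H K j) a := by
      rw [hT le_rfl, if_neg hj.ne', add_zero]
      have h1 : isoEval U (iterPoly H 1 0 K) e - U (isoEval U (iterPoly H 1 0 K) e) =
          (2 / ((K + 1 : ℕ) : ℝ)) • e := by
        have h2 := congrArg (fun p => isoEval U p e) (one_sub_X_mul_tailPoly_zero H K hinv)
        simp only [isoEval_mul, isoEval_C, map_sub, LinearMap.sub_apply, map_one,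
          Module.End.one_apply, h.pow_eq, isoEval_X] at h2
        rw [hbase]
        refine smul_right_injective E hN ?_
        simp only [smul_smul]
        rw [mul_div_cancel₀ _ hN, two_smul, smul_sub, h2, sub_neg_eq_add]
      have h3 : w K - U (w K) = isoEval U (X * certPoly H K j) a := by
        simp only [hw]
        rw [hlast, certPoly, if_neg hj.ne, mul_comm X, isoEval_mul, isoEval_X, isoEval_mul, map_sub,
          LinearMap.sub_apply, isoEval_X, map_one, Module.End.one_apply]
      simp only [hy]
      rw [← h1, ← h3, map_add, map_smul, smul_sub]
      abel
    rw [hres, norm_add_sq_real, norm_smul, h.norm_eq, inner_smul_left, inner_smul_right]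
    have h1 : (‖2 / ((K + 1 : ℕ) : ℝ)‖ * 1) ^ 2 = 4 / ((K + 1 : ℕ) : ℝ) ^ 2 := by
      rw [mul_one, Real.norm_eq_abs, sq_abs, div_pow]; norm_num
    rw [h1]
    have h2 : 0 < 2 / ((K + 1 : ℕ) : ℝ) * (ε * inner ℝ e (isoEval U (X * certPoly H K j) a)) := by
      positivity
    have h3 := sq_nonneg ‖ε • isoEval U (X * certPoly H K j) a‖
    simp only [conj_trivial]
    linarith

lemma IsNegacyclic.exists_nonexpansive {K : ℕ} {U : E ≃ₗᵢ[ℝ] E} {e : E} {H : ℕ → ℕ → ℝ}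
    (h : IsNegacyclic (K + 1) U e)
    (hinv : ∀ m, 1 ≤ m → m ≤ K →
      Pinv H K m = 1 / ((K + 1 : ℕ) : ℝ) * (Nat.choose (K + 1) (m + 1) : ℝ))
    {i j : ℕ} (hji : j < i) (hi : i ≤ K) (hneg : lamStar (K + 1) H (i + 1) (j + 1) < 0) :
    ∃ (T : E → E) (y : ℕ → E), (∀ v w, ‖T v - T w‖ ≤ ‖v - w‖) ∧ T 0 = 0 ∧ y 0 = e ∧
      (∀ k, k < K →
        y (k + 1) = y k - ∑ j ∈ range (k + 1), H (k + 1) (j + 1) • (y j - T (y j))) ∧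
      4 / ((K + 1 : ℕ) : ℝ) ^ 2 < ‖y K - T (y K)‖ ^ 2 := by
  have hN : (0 : ℝ) < ((K + 1 : ℕ) : ℝ) := by positivity
  set v : ℕ → E := fun k => isoEval U.symm (X * certPoly H K k) e with hv
  have hvx (k : ℕ) (x : E) : inner ℝ (v k) x = inner ℝ e (isoEval U (X * certPoly H K k) x) :=
    inner_isoEval_symm U _ _ _
  have hdual {k l : ℕ} (hk : k ≤ K) (hl : l ≤ K) :
      inner ℝ (v k) (isoEval U (iterPoly H 1 0 l) e) =
        if k = l then 1 / ((K + 1 : ℕ) : ℝ) else 0 := by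
    rw [hvx, ← isoEval_mul, mul_assoc]
    exact h.inner_certPoly_mul_iterPoly hinv hk hl
  have hgram : inner ℝ (v i) (v j) * ((K + 1 : ℕ) : ℝ) =
      -lamStar (K + 1) H (i + 1) (j + 1) := by
    rw [h.lamStar_eq hji hi]
    simp only [hv, isoEval_mul, isoEval_X, LinearIsometryEquiv.inner_map_map]
    rw [real_inner_comm]
    ring
  have hij : 0 < inner ℝ (v i) (v j) := by
    refine pos_of_mul_pos_left (b := ((K + 1 : ℕ) : ℝ)) ?_ hN.le
    rw [hgram]; linarith
  set δ : ℝ := inner ℝ (v i) (v j) / (‖v j‖ ^ 2 + 1) with hδ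
  have hδpos : 0 < δ := by positivity
  have hδlt : δ * ‖v j‖ ^ 2 < inner ℝ (v i) (v j) := by
    have : δ * (‖v j‖ ^ 2 + 1) = inner ℝ (v i) (v j) := by rw [hδ]; field_simp
    linarith
  have hax {l : ℕ} (hl : l ≤ K) : inner ℝ (v i - δ • v j) (isoEval U (iterPoly H 1 0 l) e) =
      (if i = l then 1 / ((K + 1 : ℕ) : ℝ) else 0) -
        δ * if j = l then 1 / ((K + 1 : ℕ) : ℝ) else 0 := by
    rw [inner_sub_left, inner_smul_left, hdual hi hl, hdual (by omega) hl, conj_trivial]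
  have hpos : 0 < inner ℝ (v j) (v i - δ • v j) := by
    rw [inner_sub_right, inner_smul_right, real_inner_self_eq_norm_sq, real_inner_comm]
    linarith
  refine exists_nonexpansive_of_direction h hinv (hji.trans_le hi) (a := v i - δ • v j)
    (η := δ * (1 / ((K + 1 : ℕ) : ℝ))) ?_ (by positivity) ?_ ?_ ?_
  · intro h0
    rw [h0, inner_zero_right] at hpos
    exact lt_irrefl _ hpos
  · rw [hax (by omega), if_neg hji.ne', if_pos rfl, zero_sub]
  · intro k hk hkj
    rw [hax hk, if_neg hkj.symm, mul_zero, sub_zero]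
    split_ifs <;> positivity
  · rw [← hvx]; exact hpos

end Negacyclic

/-- **Negative H-certificate implies suboptimality (Theorem 6.1).**
If `H` satisfies H-invariance but `λ*_{i₀,j₀}(H) < 0` for some `1 ≤ j₀ < i₀ ≤ N`, then there
exist a nonexpansive `T : ℝ^{N+1} → ℝ^{N+1}` with a fixed point `y⋆` and `y₀` with
`‖y₀ − y⋆‖ = 1` such that the H-matrix algorithm iterates satisfy
`‖y_{N−1} − T y_{N−1}‖² > 4/N²`. -/
theorem negative_certificate_suboptimal (N : ℕ) (hN : 2 ≤ N) (H : ℕ → ℕ → ℝ)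
    (hinv : ∀ m, 1 ≤ m → m ≤ N - 1 →
      Pinv H (N - 1) m = 1 / (N : ℝ) * (Nat.choose N (m + 1) : ℝ))
    (i0 j0 : ℕ) (hj0 : 1 ≤ j0) (hji : j0 < i0) (hi0 : i0 ≤ N)
    (hneg : lamStar N H i0 j0 < 0) :
    ∃ (T : EuclideanSpace ℝ (Fin (N + 1)) → EuclideanSpace ℝ (Fin (N + 1)))
      (ystar y0 : EuclideanSpace ℝ (Fin (N + 1)))
      (y : ℕ → EuclideanSpace ℝ (Fin (N + 1))),
      (∀ v w, ‖T v - T w‖ ≤ ‖v - w‖) ∧ T ystar = ystar ∧ ‖y0 - ystar‖ = 1 ∧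
      y 0 = y0 ∧
      (∀ k, k < N - 1 →
        y (k + 1) = y k - ∑ j ∈ Finset.range (k + 1), H (k + 1) (j + 1) • (y j - T (y j))) ∧
      4 / (N : ℝ) ^ 2 < ‖y (N - 1) - T (y (N - 1))‖ ^ 2 := by
  obtain ⟨K, rfl⟩ : ∃ K, N = K + 1 := ⟨N - 1, by omega⟩
  obtain ⟨i, rfl⟩ : ∃ i, i0 = i + 1 := ⟨i0 - 1, by omega⟩
  obtain ⟨j, rfl⟩ : ∃ j, j0 = j + 1 := ⟨j0 - 1, by omega⟩
  obtain ⟨U, e, he⟩ := exists_isNegacyclic K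
  obtain ⟨T, y, hT, hT0, hy0, hy, hlt⟩ :=
    he.exists_nonexpansive hinv (Nat.lt_of_succ_lt_succ hji) (Nat.le_of_succ_le_succ hi0) hneg
  exact ⟨T, 0, e, y, hT, hT0, by rw [sub_zero, he.norm_eq], hy0, hy, hlt⟩
end

section
/- Let N ≥ 2, let H be an H-matrix satisfying the H-invariance conditions P(N−1,m;H) = (1/N)·C(N,m+1) for m = 1,…,N−1, let G be the worst-case matrix, T = I − 2G, y₀ = −(1/√N)(e₁ + ⋯ + e_N), let y₁,…,y_{N−1} be the H-matrix algorithm iterates, and set g_i = G y_{i−1} and x_i = y_{i−1} − g_i for i = 1,…,N. Let G₀ be the Gram matrix of (g₁,…,g_N, y₀). Then: (a) ⟨x_i − x_j, g_i − g_j⟩ = 0 for all 1 ≤ j < i ≤ N, and ⟨x_i, g_i⟩ = 0 for all i = 1,…,N; (b) ⟨g_i, g_N⟩ = 1/N² for all i = 1,…,N, and det G₀ = 0; (c) for k = 2,…,N, the leading k×k principal minor of G₀ equals (1/N^k)·h_{1,1}^{2k−2}·h_{2,2}^{2k−4}·⋯·h_{k−1,k−1}^{2} > 0; in particular the leading N×N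 principal submatrix of G₀ is positive definite. -/
open Finset

/-- The worst-case matrix `G ∈ ℝ^{N×N}`: diagonal entries `1/2`, subdiagonal entries `−1/2`,
top-right entry `G_{1,N} = 1/2`, all other entries `0`. -/
noncomputable def Gmat (N : ℕ) : Matrix (Fin N) (Fin N) ℝ := Matrix.of fun i j =>
  if i = j then 1 / 2
  else if (i : ℕ) = (j : ℕ) + 1 then -(1 / 2)
  else if (i : ℕ) = 0 ∧ (j : ℕ) = N - 1 then 1 / 2
  else 0

/-- The index sequences `1 ≤ j(1) ≤ i(1) < j(2) ≤ i(2) < ⋯ < j(m) ≤ i(m) ≤ k`. -/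
def indexChains (k m : ℕ) : Finset (Fin m → ℕ × ℕ) :=
  (Fintype.piFinset fun _ => Finset.range (k + 1) ×ˢ Finset.range (k + 1)).filter fun f =>
    (∀ r, 1 ≤ (f r).2 ∧ (f r).2 ≤ (f r).1) ∧ ∀ r s, r < s → (f r).1 < (f s).2

lemma mem_indexChains {k m : ℕ} {f : Fin m → ℕ × ℕ} :
    f ∈ indexChains k m ↔ (∀ r, 1 ≤ (f r).2 ∧ (f r).2 ≤ (f r).1 ∧ (f r).1 ≤ k) ∧
      ∀ r s, r < s → (f r).1 < (f s).2 := by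
  simp only [indexChains, mem_filter, Fintype.mem_piFinset, mem_product, mem_range]
  constructor
  · rintro ⟨h1, h2, h3⟩
    exact ⟨fun r => ⟨(h2 r).1, (h2 r).2, Nat.lt_succ_iff.1 (h1 r).1⟩, h3⟩
  · rintro ⟨h1, h2⟩
    refine ⟨fun r => ?_, fun r => ⟨(h1 r).1, (h1 r).2.1⟩, h2⟩
    have := h1 r
    omega

lemma Pinv_eq_sum_indexChains (H : ℕ → ℕ → ℝ) (k m : ℕ) :
    Pinv H k m = ∑ f ∈ indexChains k m, ∏ r, H (f r).1 (f r).2 := by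
  cases m with
  | zero =>
    have h : indexChains k 0 = {Fin.elim0} := by
      ext f
      simp [mem_indexChains, eq_iff_true_of_subsingleton]
    simp [Pinv, h]
  | succ m =>
    rw [Pinv, ← Finset.sum_filter]
    refine Finset.sum_bij (fun f _ r => (((f r).1 : ℕ), ((f r).2 : ℕ))) ?_ ?_ ?_ ?_
    · intro f hf
      simp only [mem_filter, mem_univ, true_and] at hf
      obtain ⟨h1, h2⟩ := hf
      have hmono : StrictMono fun r => ((f r).1 : ℕ) :=
        Fin.strictMono_iff_lt_succ.2 fun r => lt_of_lt_of_le (h2 r) (h1 _).2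
      refine mem_indexChains.2 ⟨fun r => ⟨(h1 r).1, (h1 r).2, Nat.lt_succ_iff.1 (f r).1.2⟩, ?_⟩
      intro r s hrs
      obtain ⟨t, rfl⟩ := Fin.exists_succ_eq.2 (Fin.ne_zero_of_lt hrs)
      exact lt_of_le_of_lt (hmono.monotone (Fin.le_castSucc_iff.2 hrs)) (h2 t)
    · intro f _ f' _ h
      funext r
      have := congrFun h r
      simp only [Prod.mk.injEq] at this
      exact Prod.ext (Fin.ext this.1) (Fin.ext this.2)
    · intro f hf
      obtain ⟨h1, h2⟩ := mem_indexChains.1 hf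
      refine ⟨fun r => (⟨(f r).1, ?_⟩, ⟨(f r).2, ?_⟩), ?_, rfl⟩
      · have := h1 r
        omega
      · have := h1 r
        omega
      · simp only [mem_filter, mem_univ, true_and]
        exact ⟨fun r => ⟨(h1 r).1, (h1 r).2.1⟩, fun r => h2 _ _ Fin.castSucc_lt_succ⟩
    · intro f _
      rfl

lemma Pinv_succ_eq_sum (H : ℕ → ℕ → ℝ) (k m : ℕ) :
    Pinv H k (m + 1) =
      ∑ i ∈ Finset.range k, ∑ j ∈ Finset.range (i + 1), H (i + 1) (j + 1) * Pinv H j m := by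
  simp only [Pinv_eq_sum_indexChains, Finset.mul_sum]
  simp only [Finset.sum_sigma']
  refine Finset.sum_bij'
    (fun f _ => ⟨(f (Fin.last m)).1 - 1, (f (Fin.last m)).2 - 1, fun r => f r.castSucc⟩)
    (fun p _ => Fin.snoc (α := fun _ => ℕ × ℕ) p.2.2 (p.1 + 1, p.2.1 + 1)) ?_ ?_ ?_ ?_ ?_
  · intro f hf
    obtain ⟨h1, h2⟩ := mem_indexChains.1 hf
    have hl := h1 (Fin.last m)
    simp only [mem_sigma, mem_range, mem_indexChains]
    refine ⟨by omega, by omega, fun r => ⟨(h1 _).1, (h1 _).2.1, ?_⟩, fun r s hrs => h2 _ _ hrs⟩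
    have := h2 r.castSucc (Fin.last m) (Fin.castSucc_lt_last r)
    omega
  · rintro ⟨i, j, f⟩ hf
    simp only [mem_sigma, mem_range, mem_indexChains] at hf
    obtain ⟨hi, hj, h1, h2⟩ := hf
    refine mem_indexChains.2 ⟨fun r => ?_, fun r s => ?_⟩
    · refine Fin.lastCases ?_ (fun r => ?_) r
      · simp only [Fin.snoc_last]
        omega
      · simp only [Fin.snoc_castSucc]
        have := h1 r
        omega
    · refine Fin.lastCases ?_ (fun r => ?_) r
      · intro h
        exact absurd h (not_lt.2 (Fin.le_last s))
      · refine Fin.lastCases ?_ (fun s => ?_) s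
        · intro _
          simp only [Fin.snoc_last, Fin.snoc_castSucc]
          have := h1 r
          omega
        · intro hrs
          simp only [Fin.snoc_castSucc]
          exact h2 r s hrs
  · intro f hf
    have hl := (mem_indexChains.1 hf).1 (Fin.last m)
    funext r
    refine Fin.lastCases ?_ (fun r => ?_) r
    · simp only [Fin.snoc_last]
      exact Prod.ext (by simp only; omega) (by simp only; omega)
    · simp only [Fin.snoc_castSucc]
  · rintro ⟨i, j, f⟩ _
    simp
  · intro f hf
    have hl := (mem_indexChains.1 hf).1 (Fin.last m)
    simp only
    rw [Fin.prod_univ_castSucc, mul_comm, Nat.sub_add_cancel (by omega),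
      Nat.sub_add_cancel (by omega)]

lemma Pinv_succ_succ (H : ℕ → ℕ → ℝ) (k m : ℕ) :
    Pinv H (k + 1) (m + 1) = Pinv H k (m + 1) +
      ∑ j ∈ Finset.range (k + 1), H (k + 1) (j + 1) * Pinv H j m := by
  rw [Pinv_succ_eq_sum, Pinv_succ_eq_sum, Finset.sum_range_succ]

lemma Pinv_eq_zero_of_lt (H : ℕ → ℕ → ℝ) {k m : ℕ} (h : k < m) : Pinv H k m = 0 := by
  induction m generalizing k with
  | zero => omega
  | succ m ih =>
    rw [Pinv_succ_eq_sum]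
    refine Finset.sum_eq_zero fun i hi => Finset.sum_eq_zero fun j hj => ?_
    rw [Finset.mem_range] at hi hj
    rw [ih (by omega), mul_zero]

open Matrix in
lemma Gmat_mulVec_zero (n : ℕ) (v : Fin (n + 2) → ℝ) :
    (Gmat (n + 2) *ᵥ v) 0 = (v 0 + v (Fin.last (n + 1))) / 2 := by
  have h : ∀ j, Gmat (n + 2) 0 j =
      (if j = 0 then 1 / 2 else 0) + (if j = Fin.last (n + 1) then 1 / 2 else 0) := by
    intro j
    simp only [Gmat, Matrix.of_apply, Fin.ext_iff, Fin.val_zero, Fin.val_last]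
    grind
  simp only [Matrix.mulVec, dotProduct, h, add_mul, ite_mul, zero_mul, Finset.sum_add_distrib,
    Finset.sum_ite_eq', Finset.mem_univ, if_true]
  ring

open Matrix in
lemma Gmat_mulVec_succ (n : ℕ) (v : Fin (n + 2) → ℝ) (i : Fin (n + 1)) :
    (Gmat (n + 2) *ᵥ v) i.succ = (v i.succ - v i.castSucc) / 2 := by
  have h : ∀ j, Gmat (n + 2) i.succ j =
      (if j = i.succ then 1 / 2 else 0) + (if j = i.castSucc then -(1 / 2) else 0) := by
    intro j
    simp only [Gmat, Matrix.of_apply, Fin.ext_iff, Fin.val_succ, Fin.val_castSucc]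
    grind
  simp only [Matrix.mulVec, dotProduct, h, add_mul, ite_mul, zero_mul, Finset.sum_add_distrib,
    Finset.sum_ite_eq', Finset.mem_univ, if_true]
  ring

open Matrix in
/-- `G = (I - T) / 2` with `T` an isometry. -/
lemma sub_Gmat_mulVec_dotProduct (n : ℕ) (v : Fin (n + 2) → ℝ) :
    (v - Gmat (n + 2) *ᵥ v) ⬝ᵥ (Gmat (n + 2) *ᵥ v) = 0 := by
  have h1 := Fin.sum_univ_succ fun i => v i ^ 2
  have h2 := Fin.sum_univ_castSucc fun i => v i ^ 2
  rw [dotProduct, Fin.sum_univ_succ]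
  simp only [Pi.sub_apply, Gmat_mulVec_zero, Gmat_mulVec_succ]
  have h3 : ∀ i : Fin (n + 1), (v i.succ - (v i.succ - v i.castSucc) / 2) *
      ((v i.succ - v i.castSucc) / 2) = v i.succ ^ 2 / 4 - v i.castSucc ^ 2 / 4 := by
    intro i
    ring
  simp only [h3, Finset.sum_sub_distrib, ← Finset.sum_div]
  linarith

open Matrix in
lemma Gmat_mulVec_dotProduct_const (n : ℕ) (v : Fin (n + 2) → ℝ) (c : ℝ) :
    (Gmat (n + 2) *ᵥ v) ⬝ᵥ (fun _ => c) = v (Fin.last (n + 1)) * c := by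
  have h1 := Fin.sum_univ_succ v
  have h2 := Fin.sum_univ_castSucc v
  rw [dotProduct, ← Finset.sum_mul, Fin.sum_univ_succ]
  simp only [Gmat_mulVec_zero, Gmat_mulVec_succ, ← Finset.sum_div, Finset.sum_sub_distrib]
  congr 1
  linarith

open Matrix in
lemma one_sub_two_smul_Gmat_pow_mulVec_const (n : ℕ) (c : ℝ) (k : ℕ) (hk : k ≤ n + 2)
    (i : Fin (n + 2)) :
    ((1 - (2 : ℝ) • Gmat (n + 2)) ^ k *ᵥ fun _ => c) i = if (i : ℕ) < k then -c else c := by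
  induction k generalizing i with
  | zero => simp
  | succ k ih =>
    rw [pow_succ', ← mulVec_mulVec, sub_mulVec, one_mulVec, smul_mulVec, Pi.sub_apply,
      Pi.smul_apply, smul_eq_mul]
    specialize ih (by omega)
    refine Fin.cases ?_ (fun i => ?_) i
    · rw [Gmat_mulVec_zero, ih, ih,
        if_neg (by simp only [Fin.val_last]; omega : ¬ (Fin.last (n + 1)).val < k)]
      simp
      ring
    · rw [Gmat_mulVec_succ, ih, ih]
      simp only [Fin.val_succ, Fin.val_castSucc, Nat.add_lt_add_iff_right]
      ring

lemma one_sub_pow_eq_one_sub_sum {R : Type*} [Ring R] [Algebra ℝ R] (a : R) (n : ℕ) :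
    (1 - a) ^ n = 1 - ∑ m ∈ Finset.range n,
      ((-1 : ℝ) ^ m * (Nat.choose n (m + 1) : ℝ)) • a ^ (m + 1) := by
  rw [sub_eq_neg_add, (Commute.one_right (-a)).add_pow, Finset.sum_range_succ']
  simp only [one_pow, mul_one, pow_zero, Nat.choose_zero_right, Nat.cast_one]
  rw [add_comm, sub_eq_add_neg, ← Finset.sum_neg_distrib]
  congr 1
  refine Finset.sum_congr rfl fun m _ => ?_
  rw [← nsmul_eq_mul', ← Nat.cast_smul_eq_nsmul ℝ]
  rcases Nat.even_or_odd m with hm | hm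
  · simp [hm.neg_one_pow, hm.add_one.neg_pow]
  · simp [hm.neg_one_pow, hm.add_one.neg_pow]

open Matrix in
lemma Gmat_mulVec_sum_choose (n : ℕ) (c : ℝ) :
    ∑ m ∈ Finset.range (n + 2), ((-1 : ℝ) ^ m * (Nat.choose (n + 2) (m + 1) : ℝ)) •
      (((2 : ℝ) • Gmat (n + 2)) ^ (m + 1) *ᵥ fun _ => c) = fun _ => 2 * c := by
  set A := (2 : ℝ) • Gmat (n + 2)
  have h1 := one_sub_pow_eq_one_sub_sum A (n + 2)
  have h2 : (1 - A) ^ (n + 2) *ᵥ (fun _ => c) = fun _ => -c := by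
    funext i
    rw [one_sub_two_smul_Gmat_pow_mulVec_const n c _ le_rfl, if_pos i.2]
  rw [h1, sub_mulVec, one_mulVec, sum_mulVec] at h2
  simp only [smul_mulVec] at h2
  rw [sub_eq_iff_eq_add] at h2
  funext i
  have := congrFun h2 i
  simp only [Pi.add_apply] at this
  linarith

open Matrix in
lemma algorithm_eq_sum_Pinv {n : ℕ} {A : Matrix (Fin (n + 2)) (Fin (n + 2)) ℝ}
    {H : ℕ → ℕ → ℝ} {y : ℕ → Fin (n + 2) → ℝ}
    (hrec : ∀ k, k < n + 1 →
      y (k + 1) = y k - ∑ j ∈ Finset.range (k + 1), H (k + 1) (j + 1) • (A *ᵥ y j))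
    (k : ℕ) (hk : k ≤ n + 1) :
    y k = ∑ m ∈ Finset.range (n + 2), ((-1 : ℝ) ^ m * Pinv H k m) • (A ^ m *ᵥ y 0) := by
  induction k using Nat.strong_induction_on with
  | _ k ih =>
    cases k with
    | zero =>
      rw [Finset.sum_range_succ', Finset.sum_eq_zero]
      · simp [Pinv]
      · intro m _
        rw [Pinv_eq_zero_of_lt H (Nat.succ_pos m), mul_zero, zero_smul]
    | succ k =>
      have h1 : ∀ j ∈ Finset.range (k + 1), H (k + 1) (j + 1) • (A *ᵥ y j) =
          ∑ m ∈ Finset.range (n + 1),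
            ((-1 : ℝ) ^ m * (H (k + 1) (j + 1) * Pinv H j m)) • (A ^ (m + 1) *ᵥ y 0) := by
        intro j hj
        rw [Finset.mem_range] at hj
        rw [ih j hj (by omega), Finset.sum_range_succ,
          Pinv_eq_zero_of_lt H (by omega : j < n + 1), mul_zero, zero_smul, add_zero,
          mulVec_sum, Finset.smul_sum]
        refine Finset.sum_congr rfl fun m _ => ?_
        rw [mulVec_smul, mulVec_mulVec, ← pow_succ', smul_smul]
        congr 1
        ring
      rw [hrec k (by omega), ih k (by omega) (by omega), Finset.sum_congr rfl h1,
        Finset.sum_comm, Finset.sum_range_succ' _ (n + 1), Finset.sum_range_succ' _ (n + 1)]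
      simp only [Pinv_succ_succ, ← Finset.sum_smul, ← Finset.mul_sum]
      have h2 : ∀ i : ℕ, Pinv H i 0 = 1 := fun _ => rfl
      rw [h2, h2, add_sub_right_comm, ← Finset.sum_sub_distrib]
      congr 1
      refine Finset.sum_congr rfl fun m _ => ?_
      rw [← sub_smul]
      congr 1
      ring

open Matrix in
lemma algorithm_apply_of_le {n : ℕ} {H : ℕ → ℕ → ℝ} {y : ℕ → Fin (n + 2) → ℝ} {c : ℝ}
    (hinit : y 0 = fun _ => c)
    (hrec : ∀ k, k < n + 1 → y (k + 1) = y k - ∑ j ∈ Finset.range (k + 1),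
      H (k + 1) (j + 1) • (((2 : ℝ) • Gmat (n + 2)) *ᵥ y j))
    (k : ℕ) (hk : k ≤ n + 1) (i : Fin (n + 2)) (hi : k ≤ i) : y k i = c := by
  induction k using Nat.strong_induction_on generalizing i with
  | _ k ih =>
    cases k with
    | zero => rw [hinit]
    | succ k =>
      rw [hrec k (by omega), Pi.sub_apply, ih k (by omega) (by omega) i (by omega),
        Finset.sum_apply, Finset.sum_eq_zero, sub_zero]
      intro j hj
      rw [Finset.mem_range] at hj
      obtain ⟨i, rfl⟩ := Fin.exists_succ_eq.2 (by rintro rfl; simp at hi : i ≠ 0)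
      rw [Fin.val_succ] at hi
      rw [Pi.smul_apply, smul_mulVec, Pi.smul_apply, Gmat_mulVec_succ,
        ih j (by omega) (by omega) _ (by simp only [Fin.val_succ]; omega),
        ih j (by omega) (by omega) _ (by simp only [Fin.val_castSucc]; omega)]
      simp

open Matrix in
lemma Gmat_mulVec_algorithm_apply_of_lt {n : ℕ} {H : ℕ → ℕ → ℝ} {y : ℕ → Fin (n + 2) → ℝ}
    {c : ℝ} (hinit : y 0 = fun _ => c)
    (hrec : ∀ k, k < n + 1 → y (k + 1) = y k - ∑ j ∈ Finset.range (k + 1),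
      H (k + 1) (j + 1) • (((2 : ℝ) • Gmat (n + 2)) *ᵥ y j))
    (k : ℕ) (hk : k ≤ n + 1) (i : Fin (n + 2)) (hi : k < i) :
    (Gmat (n + 2) *ᵥ y k) i = 0 := by
  obtain ⟨i, rfl⟩ := Fin.exists_succ_eq.2 (by rintro rfl; simp at hi : i ≠ 0)
  rw [Fin.val_succ] at hi
  rw [Gmat_mulVec_succ,
    algorithm_apply_of_le hinit hrec k hk _ (by simp only [Fin.val_succ]; omega),
    algorithm_apply_of_le hinit hrec k hk _ (by simp only [Fin.val_castSucc]; omega)]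
  simp

open Matrix in
lemma Gmat_mulVec_algorithm_apply_self {n : ℕ} {H : ℕ → ℕ → ℝ} {y : ℕ → Fin (n + 2) → ℝ}
    {c : ℝ} (hinit : y 0 = fun _ => c)
    (hrec : ∀ k, k < n + 1 → y (k + 1) = y k - ∑ j ∈ Finset.range (k + 1),
      H (k + 1) (j + 1) • (((2 : ℝ) • Gmat (n + 2)) *ᵥ y j))
    (k : ℕ) (hk : k < n + 2) :
    (Gmat (n + 2) *ᵥ y k) ⟨k, hk⟩ = c * ∏ j ∈ Finset.range k, H (j + 1) (j + 1) := by
  induction k with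
  | zero =>
    have : (⟨0, hk⟩ : Fin (n + 2)) = 0 := rfl
    rw [this, Gmat_mulVec_zero, hinit]
    simp
  | succ k ih =>
    have h : (⟨k + 1, hk⟩ : Fin (n + 2)) = (⟨k, by omega⟩ : Fin (n + 1)).succ := rfl
    have h' : (⟨k, by omega⟩ : Fin (n + 1)).castSucc = (⟨k, by omega⟩ : Fin (n + 2)) := rfl
    have h1 := algorithm_apply_of_le hinit hrec k (by omega) ⟨k, by omega⟩ le_rfl
    have h2 : y (k + 1) ⟨k, by omega⟩ = c - H (k + 1) (k + 1) *
        (2 * (Gmat (n + 2) *ᵥ y k) ⟨k, by omega⟩) := by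
      rw [hrec k (by omega), Pi.sub_apply, h1, Finset.sum_apply, Finset.sum_range_succ,
        Finset.sum_eq_zero, zero_add, smul_mulVec]
      · rfl
      · intro j hj
        rw [Finset.mem_range] at hj
        rw [smul_mulVec, Pi.smul_apply, Pi.smul_apply,
          Gmat_mulVec_algorithm_apply_of_lt hinit hrec j (by omega) _ hj]
        simp
    rw [h, Gmat_mulVec_succ, ← h, h',
      algorithm_apply_of_le hinit hrec (k + 1) (by omega) _ le_rfl, h2, ih (by omega),
      Finset.prod_range_succ]
    ring

lemma prod_range_sq_prod_range (c : ℝ) (f : ℕ → ℝ) (k : ℕ) :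
    ∏ i ∈ Finset.range k, (c * ∏ j ∈ Finset.range i, f (j + 1)) ^ 2 =
      (c ^ 2) ^ k * ∏ j ∈ Finset.Icc 1 (k - 1), f j ^ (2 * (k - j)) := by
  have h : ∏ i ∈ Finset.range k, (c * ∏ j ∈ Finset.range i, f (j + 1)) ^ 2 =
      (c ^ 2) ^ k * ∏ j ∈ Finset.range k, f (j + 1) ^ (2 * (k - (j + 1))) := by
    induction k with
    | zero => simp
    | succ k ih =>
      have h1 : ∀ j ∈ Finset.range k, f (j + 1) ^ (2 * (k + 1 - (j + 1))) =
          f (j + 1) ^ (2 * (k - (j + 1))) * f (j + 1) ^ 2 := by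
        intro j hj
        rw [Finset.mem_range] at hj
        rw [← pow_add]
        congr 1
        omega
      rw [Finset.prod_range_succ, Finset.prod_range_succ, ih, Finset.prod_congr rfl h1,
        Finset.prod_mul_distrib, Finset.prod_pow, Nat.sub_self, mul_zero, pow_zero, mul_one]
      ring
  rw [h]
  cases k with
  | zero => simp
  | succ k =>
    rw [Finset.prod_range_succ, Nat.sub_self, mul_zero, pow_zero, mul_one, Nat.add_sub_cancel,
      Finset.range_eq_Ico, Finset.prod_Ico_add' (fun j => f j ^ (2 * (k + 1 - j))) 0 k 1]
    rfl

open Matrix in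
/-- The Gram matrix of vectors that are triangular in the standard basis. -/
lemma gram_eq_mul_transpose {N k : ℕ} (h : k ≤ N) (v : Fin k → Fin N → ℝ)
    (hv : ∀ (a : Fin k) (i : Fin N), (a : ℕ) < i → v a i = 0) :
    (Matrix.of fun a b => v a ⬝ᵥ v b) =
      (Matrix.of fun a i => v a (Fin.castLE h i)) *
        (Matrix.of fun a i => v a (Fin.castLE h i))ᵀ := by
  ext a b
  simp only [of_apply, mul_apply, transpose_apply, dotProduct]
  refine (Fintype.sum_of_injective (Fin.castLE h) (Fin.castLE_injective h) _ _ ?_ ?_).symm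
  · intro i hi
    rw [hv a i, zero_mul]
    by_contra hlt
    exact hi ⟨⟨i, by omega⟩, rfl⟩
  · intro i
    rfl

open Matrix in
/-- **Properties of the worst-case Gram matrix under H-invariance (Lemma 6.3).**
With `T = I − 2G`, `y₀ = −(1/√N)(e₁+⋯+e_N)`, iterates `y_k`, `g_i = G y_{i−1}`,
`x_i = y_{i−1} − g_i`, and `G₀` the Gram matrix of `(g₁,…,g_N,y₀)`:
(a) `⟨x_i − x_j, g_i − g_j⟩ = 0` and `⟨x_i, g_i⟩ = 0`;
(b) `⟨g_i, g_N⟩ = 1/N²` and `det G₀ = 0`;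
(c) the leading `k×k` principal minor of `G₀` equals
    `(1/N^k)·∏_{j=1}^{k−1} h_{j,j}^{2(k−j)} > 0` for `k = 2,…,N`, and the leading `N×N`
    principal submatrix of `G₀` is positive definite. -/
theorem worst_case_gram_matrix_properties (N : ℕ) (hN : 2 ≤ N) (H : ℕ → ℕ → ℝ)
    (hinv : ∀ m, 1 ≤ m → m ≤ N - 1 →
      Pinv H (N - 1) m = 1 / (N : ℝ) * (Nat.choose N (m + 1) : ℝ))
    (T : (Fin N → ℝ) → (Fin N → ℝ)) (hT : ∀ v, T v = v - (2 : ℝ) • (Gmat N).mulVec v)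
    (y0 : Fin N → ℝ) (hy0 : y0 = fun _ => -(1 / Real.sqrt N))
    (y : ℕ → Fin N → ℝ) (hyinit : y 0 = y0)
    (hrec : ∀ k, k < N - 1 →
      y (k + 1) = y k - ∑ j ∈ Finset.range (k + 1), H (k + 1) (j + 1) • (y j - T (y j)))
    (g : ℕ → Fin N → ℝ) (hg : ∀ i, 1 ≤ i → i ≤ N → g i = (Gmat N).mulVec (y (i - 1)))
    (x : ℕ → Fin N → ℝ) (hx : ∀ i, 1 ≤ i → i ≤ N → x i = y (i - 1) - g i)
    (G0 : Matrix (Fin (N + 1)) (Fin (N + 1)) ℝ)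
    (hG0 : ∀ a b : Fin (N + 1),
      G0 a b = (if (a : ℕ) < N then g ((a : ℕ) + 1) else y0) ⬝ᵥ
               (if (b : ℕ) < N then g ((b : ℕ) + 1) else y0)) :
    ((∀ i j, 1 ≤ j → j < i → i ≤ N → (x i - x j) ⬝ᵥ (g i - g j) = 0) ∧
      (∀ i, 1 ≤ i → i ≤ N → x i ⬝ᵥ g i = 0)) ∧
    ((∀ i, 1 ≤ i → i ≤ N → g i ⬝ᵥ g N = 1 / (N : ℝ) ^ 2) ∧ G0.det = 0) ∧
    ((∀ k, 2 ≤ k → (hkN : k ≤ N) →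
        (G0.submatrix (Fin.castLE (by omega : k ≤ N + 1))
            (Fin.castLE (by omega : k ≤ N + 1))).det
          = 1 / (N : ℝ) ^ k * ∏ j ∈ Finset.Icc 1 (k - 1), H j j ^ (2 * (k - j)) ∧
        0 < (G0.submatrix (Fin.castLE (by omega : k ≤ N + 1))
            (Fin.castLE (by omega : k ≤ N + 1))).det) ∧
      (G0.submatrix (Fin.castLE (by omega : N ≤ N + 1))
        (Fin.castLE (by omega : N ≤ N + 1))).PosDef) := by
  obtain ⟨n, rfl⟩ : ∃ n, N = n + 2 := ⟨N - 2, by omega⟩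
  rw [show n + 2 - 1 = n + 1 by omega] at hinv hrec
  set c : ℝ := -(1 / Real.sqrt ((n + 2 : ℕ) : ℝ)) with hc
  have hNpos : (0 : ℝ) < ((n + 2 : ℕ) : ℝ) := by positivity
  have hcsq : c * c = 1 / ((n + 2 : ℕ) : ℝ) := by
    rw [hc, neg_mul_neg, div_mul_div_comm, Real.mul_self_sqrt hNpos.le, one_mul]
  have hc0 : c ≠ 0 := by
    intro h
    rw [h, zero_mul] at hcsq
    exact (one_div_pos.2 hNpos).ne hcsq
  have hrec' : ∀ k, k < n + 1 → y (k + 1) = y k - ∑ j ∈ Finset.range (k + 1),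
      H (k + 1) (j + 1) • (((2 : ℝ) • Gmat (n + 2)) *ᵥ y j) := by
    intro k hk
    simp only [hrec k hk, hT, sub_sub_cancel, smul_mulVec]
  have hinit : y 0 = fun _ => c := hyinit.trans hy0
  have hdot : ∀ v : Fin (n + 2) → ℝ, (v - Gmat (n + 2) *ᵥ v) ⬝ᵥ (Gmat (n + 2) *ᵥ v) = 0 :=
    sub_Gmat_mulVec_dotProduct n
  have hlast : ∀ i, 1 ≤ i → i ≤ n + 2 → g i ⬝ᵥ y0 = 1 / ((n + 2 : ℕ) : ℝ) := by
    intro i hi hiN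
    rw [hg i hi hiN, hy0, Gmat_mulVec_dotProduct_const,
      algorithm_apply_of_le hinit hrec' (i - 1) (by omega) _ (by simp only [Fin.val_last]; omega),
      hcsq]
  have hgN : g (n + 2) = (1 / ((n + 2 : ℕ) : ℝ)) • y0 := by
    have h1 := algorithm_eq_sum_Pinv hrec' (n + 1) le_rfl
    have h2 : ((2 : ℝ) • Gmat (n + 2)) *ᵥ y (n + 1) =
        (1 / ((n + 2 : ℕ) : ℝ)) • fun _ => 2 * c := by
      rw [← Gmat_mulVec_sum_choose, h1, mulVec_sum, Finset.smul_sum]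
      refine Finset.sum_congr rfl fun m hm => ?_
      have h3 : Pinv H (n + 1) m =
          1 / ((n + 2 : ℕ) : ℝ) * (Nat.choose (n + 2) (m + 1) : ℝ) := by
        rcases Nat.eq_zero_or_pos m with rfl | hm0
        · rw [Nat.zero_add, Nat.choose_one_right, one_div_mul_cancel hNpos.ne']
          rfl
        · rw [Finset.mem_range] at hm
          exact hinv m hm0 (by omega)
      rw [mulVec_smul, mulVec_mulVec, ← pow_succ', h3, smul_smul, hinit]
      congr 1
      ring
    rw [hg (n + 2) (by omega) le_rfl, hy0]
    funext i
    have h4 := congrFun h2 i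
    rw [smul_mulVec] at h4
    simp only [Pi.smul_apply, smul_eq_mul] at h4 ⊢
    rw [show n + 2 - 1 = n + 1 by omega]
    linarith
  have hself : ∀ k (hk : k < n + 2), g (k + 1) ⟨k, hk⟩ =
      c * ∏ j ∈ Finset.range k, H (j + 1) (j + 1) := by
    intro k hk
    rw [hg (k + 1) (by omega) (by omega)]
    exact Gmat_mulVec_algorithm_apply_self hinit hrec' k hk
  have htri : ∀ (k : ℕ) (i : Fin (n + 2)), k < i → g (k + 1) i = 0 := by
    intro k i hki
    rw [hg (k + 1) (by omega) (by omega)]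
    exact Gmat_mulVec_algorithm_apply_of_lt hinit hrec' k (by omega) i hki
  have hprod : ∏ j ∈ Finset.range (n + 1), H (j + 1) (j + 1) ≠ 0 := by
    intro h0
    have h1 := hself (n + 1) (by omega)
    rw [h0, mul_zero, hgN, hy0] at h1
    exact mul_ne_zero (one_div_pos.2 hNpos).ne' hc0 h1
  have hH : ∀ j, j < n + 1 → H (j + 1) (j + 1) ≠ 0 := fun j hj =>
    Finset.prod_ne_zero_iff.1 hprod j (Finset.mem_range.2 hj)
  have hgram : ∀ k (hk : k ≤ n + 2) (hk' : k ≤ n + 2 + 1),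
      G0.submatrix (Fin.castLE hk') (Fin.castLE hk') =
        (Matrix.of fun (a : Fin k) (i : Fin k) => g (a + 1) (Fin.castLE hk i)) *
        (Matrix.of fun (a : Fin k) (i : Fin k) => g (a + 1) (Fin.castLE hk i))ᵀ := by
    intro k hk hk'
    rw [← gram_eq_mul_transpose hk (fun a => g (a + 1)) fun a i hai => htri a i hai]
    ext a b
    rw [submatrix_apply, hG0, of_apply, if_pos (by simp only [Fin.val_castLE]; omega),
      if_pos (by simp only [Fin.val_castLE]; omega)]
    rfl
  have hdetM : ∀ k (hk : k ≤ n + 2),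
      (Matrix.of fun (a : Fin k) (i : Fin k) => g (a + 1) (Fin.castLE hk i)).det =
        ∏ a ∈ Finset.range k, (c * ∏ j ∈ Finset.range a, H (j + 1) (j + 1)) := by
    intro k hk
    rw [det_of_isLowerTriangular, Finset.prod_range]
    · exact Finset.prod_congr rfl fun a _ => hself a _
    · intro a i hai
      exact htri a _ hai
  have hdetM0 : ∀ k (hk : k ≤ n + 2),
      (Matrix.of fun (a : Fin k) (i : Fin k) => g (a + 1) (Fin.castLE hk i)).det ≠ 0 := by
    intro k hk
    rw [hdetM k hk]
    refine Finset.prod_ne_zero_iff.2 fun a ha => mul_ne_zero hc0 ?_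
    rw [Finset.mem_range] at ha
    refine Finset.prod_ne_zero_iff.2 fun j hj => hH j ?_
    rw [Finset.mem_range] at hj
    omega
  refine ⟨⟨?_, ?_⟩, ⟨?_, ?_⟩, ?_, ?_⟩
  · intro i j hj hji hi
    have h1 : g i - g j = Gmat (n + 2) *ᵥ (y (i - 1) - y (j - 1)) := by
      rw [mulVec_sub, hg i (by omega) hi, hg j hj (by omega)]
    have h2 : x i - x j =
        y (i - 1) - y (j - 1) - Gmat (n + 2) *ᵥ (y (i - 1) - y (j - 1)) := by
      rw [← h1, hx i (by omega) hi, hx j hj (by omega)]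
      abel
    rw [h2, h1, hdot]
  · intro i hi hiN
    rw [hx i hi hiN, hg i hi hiN, hdot]
  · intro i hi hiN
    rw [hgN, dotProduct_smul, hlast i hi hiN, smul_eq_mul]
    ring
  · rw [← exists_mulVec_eq_zero_iff]
    refine ⟨Pi.single ⟨n + 1, by omega⟩ ((n + 2 : ℕ) : ℝ) - Pi.single (Fin.last (n + 2)) 1,
      fun h => ?_, ?_⟩
    · have h1 := congrFun h (Fin.last (n + 2))
      simp [Fin.ext_iff] at h1
    · funext a
      rw [mulVec_sub, mulVec_single, mulVec_single]
      simp only [Pi.sub_apply, Pi.smul_apply, col_apply, hG0, Fin.val_last, lt_irrefl, if_false,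
        MulOpposite.smul_eq_mul_unop, MulOpposite.unop_op, mul_one, Pi.zero_apply]
      rw [if_pos (show n + 1 < n + 2 by omega), hgN, dotProduct_smul, smul_eq_mul]
      field_simp
      ring
  · intro k hk hkN
    rw [hgram k hkN]
    rw [det_mul, det_transpose]
    refine ⟨?_, mul_self_pos.2 (hdetM0 k hkN)⟩
    rw [hdetM, ← sq, ← Finset.prod_pow, prod_range_sq_prod_range c (fun j => H j j) k, sq, hcsq,
      _root_.one_div_pow]
  · rw [hgram (n + 2) le_rfl, ← conjTranspose_eq_transpose_of_trivial]
    refine PosDef.mul_conjTranspose_self _ (vecMul_injective_of_isUnit ?_)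
    rw [isUnit_iff_isUnit_det]
    exact (hdetM0 (n + 2) le_rfl).isUnit
end
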